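/- arXiv:1501.03926 — 3 statements merged into one kernel-verified Lean document; each statement's English description precedes it below -/
import Mathlib

section
/- Let α ∈ (0,1) ∪ (1,2) and ρ ∈ (0,1) satisfy αρ < 1 and α(1−ρ) < 1, and set ρ̂ = 1−ρ. Then for every y ∈ (−1,1): (sin(παρ̂)/π)·∫_{−1}^{y} (y−t)^{α−1}(1−t)^{−αρ}(1+t)^{−αρ̂} dt + (sin(παρ)/π)·∫_{y}^{1} (t−y)^{α−1}(1−t)^{−αρ}(1+t)^{−αρ̂} dt = 1. (In other words, the measure on (−1,1) with density φ(t) = (1−t)^{−αρ}(1+t)^{−αρ̂} solves the Abelian integral equation ∫_{−1}^{1} ((sin(παρ̂)/π)·1_{t<y} + (sin(παρ)/π)·1_{t>y})·|t−y|^{α−1} μ(dt) = 1 for all y ∈ (−1,1).) -/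
open MeasureTheory Set Real

lemma aux_beta (a : ℝ) (h0 : 0 < a) (h1 : a < 1) :
    ∫ s in Ioo (0:ℝ) 1, s ^ (a - 1) * (1 - s) ^ (-a) = π / Real.sin (π * a) := by
  have h := Complex.betaIntegral_eq_Gamma_mul_div (a : ℂ) ((1 - a : ℝ) : ℂ) (by simpa using h0)
    (by simpa using h1)
  have e1 : ((a : ℂ) + ((1 - a : ℝ) : ℂ)) = 1 := by push_cast; ring
  rw [e1, Complex.Gamma_one, div_one, Complex.Gamma_ofReal, Complex.Gamma_ofReal,
    ← Complex.ofReal_mul, Real.Gamma_mul_Gamma_one_sub, Complex.betaIntegral] at h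
  rw [← integral_Ioc_eq_integral_Ioo, ← intervalIntegral.integral_of_le zero_le_one]
  have h2 : ∫ x in (0:ℝ)..1, (x:ℂ) ^ ((a:ℂ) - 1) * (1 - (x:ℂ)) ^ (((1 - a : ℝ) : ℂ) - 1)
      = ∫ x in (0:ℝ)..1, ((x ^ (a - 1) * (1 - x) ^ (-a) : ℝ) : ℂ) := by
    apply intervalIntegral.integral_congr
    intro x hx
    rw [uIcc_of_le zero_le_one] at hx
    have hx2 : 0 ≤ 1 - x := by linarith [hx.2]
    simp only []
    rw [Complex.ofReal_mul, Complex.ofReal_cpow hx.1, Complex.ofReal_cpow hx2]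
    push_cast
    congr 2
    ring
  rw [h2, intervalIntegral.integral_ofReal] at h
  exact_mod_cast h

lemma aux_image1 : (fun r : ℝ => r / (1 + r)) '' Ioi 0 = Ioo 0 1 := by
  ext s
  simp only [mem_image, mem_Ioi, mem_Ioo]
  constructor
  · rintro ⟨r, hr, rfl⟩
    exact ⟨by positivity, by rw [div_lt_one (by linarith)]; linarith⟩
  · rintro ⟨h0, h1⟩
    have : 0 < 1 - s := by linarith
    refine ⟨s / (1 - s), by positivity, ?_⟩
    field_simp
    ring

lemma aux_subst (a A B : ℝ) (hA : 0 < A) (hB : 0 < B) :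
    ∫ s in Ioo (0:ℝ) 1, s ^ (a - 1) * (1 - s) ^ (-a) / (A * s + B * (1 - s))
      = ∫ r in Ioi (0:ℝ), r ^ (a - 1) / (A * r + B) := by
  rw [← aux_image1, integral_image_eq_integral_abs_deriv_smul (f' := fun r => 1 / (1 + r) ^ 2)
    measurableSet_Ioi]
  · apply setIntegral_congr_fun measurableSet_Ioi
    intro r hr
    have hr : 0 < r := hr
    have h1 : 0 < 1 + r := by linarith
    have e : 1 - r / (1 + r) = (1 + r)⁻¹ := by field_simp; ring
    simp only [smul_eq_mul]
    rw [e, abs_of_pos (by positivity), Real.div_rpow hr.le h1.le, Real.inv_rpow h1.le,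
      Real.rpow_neg h1.le, Real.rpow_sub_one h1.ne']
    have : 0 < (1 + r) ^ a := by positivity
    have : 0 < A * r + B := by positivity
    field_simp
  · intro r hr
    have hr : 0 < r := hr
    have h1 : 1 + r ≠ 0 := by linarith
    have := ((hasDerivAt_id r).div ((hasDerivAt_id r).const_add 1) h1).hasDerivWithinAt (s := Ioi 0)
    refine HasDerivWithinAt.congr_deriv this ?_
    simp
  · intro r hr r' hr' h
    have hr : 0 < r := hr
    have hr' : 0 < r' := hr'
    simp only [] at h
    field_simp at h
    linarith

lemma aux_K (a A B : ℝ) (h0 : 0 < a) (h1 : a < 1) (hA : 0 < A) (hB : 0 < B) :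
    ∫ r in Ioi (0:ℝ), r ^ (a - 1) / (A * r + B) = π / Real.sin (π * a) * (A ^ (-a) * B ^ (a - 1)) := by
  have h := aux_subst a 1 1 one_pos one_pos
  have e : ∀ s : ℝ, s ^ (a - 1) * (1 - s) ^ (-a) / (1 * s + 1 * (1 - s))
      = s ^ (a - 1) * (1 - s) ^ (-a) := by intro s; ring_nf
  simp only [e] at h
  rw [aux_beta a h0 h1] at h
  have hb : 0 < B / A := by positivity
  have h2 := integral_comp_mul_left_Ioi' (fun r => r ^ (a - 1) / (A * r + B)) 0 hb
  rw [mul_zero] at h2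
  rw [← h2, h, smul_eq_mul, ← integral_const_mul, ← integral_mul_const]
  apply setIntegral_congr_fun measurableSet_Ioi
  intro r hr
  have hr : 0 < r := hr
  simp only []
  rw [Real.mul_rpow hb.le hr.le, Real.div_rpow hB.le hA.le, Real.rpow_neg hA.le,
    Real.rpow_sub_one hA.ne']
  have : 0 < A ^ a := by positivity
  field_simp

lemma aux_sin_pos (a : ℝ) (h0 : 0 < a) (h1 : a < 1) : 0 < Real.sin (π * a) := by
  apply Real.sin_pos_of_pos_of_lt_pi
  · positivity
  · nlinarith [Real.pi_pos]

lemma aux_K_int (a A B : ℝ) (h0 : 0 < a) (h1 : a < 1) (hA : 0 < A) (hB : 0 < B) :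
    IntegrableOn (fun r : ℝ => r ^ (a - 1) / (A * r + B)) (Ioi 0) := by
  apply Integrable.of_integral_ne_zero
  rw [aux_K a A B h0 h1 hA hB]
  have := aux_sin_pos a h0 h1
  positivity

lemma aux_B (a A B : ℝ) (h0 : 0 < a) (h1 : a < 1) (hA : 0 < A) (hB : 0 < B) :
    ∫ s in Ioo (0:ℝ) 1, s ^ (a - 1) * (1 - s) ^ (-a) / (A * s + B * (1 - s))
      = π / Real.sin (π * a) * (A ^ (-a) * B ^ (a - 1)) := by
  rw [aux_subst a A B hA hB, aux_K a A B h0 h1 hA hB]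

lemma aux_B_int (a A B : ℝ) (h0 : 0 < a) (h1 : a < 1) (hA : 0 < A) (hB : 0 < B) :
    IntegrableOn (fun s : ℝ => s ^ (a - 1) * (1 - s) ^ (-a) / (A * s + B * (1 - s))) (Ioo 0 1) := by
  apply Integrable.of_integral_ne_zero
  rw [aux_B a A B h0 h1 hA hB]
  have := aux_sin_pos a h0 h1
  positivity

lemma aux_inner_eq (b c s v : ℝ) (hc : 0 < c) (hc1 : c < 1) (hs : s ∈ Ioo (0:ℝ) 1) (hv : 0 < v) :
    v ^ b / ((1 + c * v) * (s + v))
      = (1 - c * s)⁻¹ * (v ^ (b - 1) / (c * v + 1) - s * (v ^ (b - 1) / (1 * v + s))) := by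
  have hs0 := hs.1
  have hcs : 0 < 1 - c * s := by nlinarith [hs.1, hs.2]
  rw [Real.rpow_sub_one hv.ne']
  have h1 : c * v + 1 ≠ 0 := by positivity
  have h2 : 1 + c * v ≠ 0 := by positivity
  have h3 : 1 * v + s ≠ 0 := by positivity
  have h4 : s + v ≠ 0 := by positivity
  rw [show c * v + 1 = 1 + c * v by ring, show 1 * v + s = s + v by ring]
  field_simp
  ring

lemma aux_inner_int (b c s : ℝ) (h0 : 0 < b) (h1 : b < 1) (hc : 0 < c) (hc1 : c < 1)
    (hs : s ∈ Ioo (0:ℝ) 1) :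
    IntegrableOn (fun v : ℝ => v ^ b / ((1 + c * v) * (s + v))) (Ioi 0) := by
  have hI := ((aux_K_int b c 1 h0 h1 hc one_pos).sub
    ((aux_K_int b 1 s h0 h1 one_pos hs.1).const_mul s)).const_mul (1 - c * s)⁻¹
  refine IntegrableOn.congr_fun hI ?_ measurableSet_Ioi
  intro v hv
  exact (aux_inner_eq b c s v hc hc1 hs hv).symm

lemma aux_inner (b c s : ℝ) (h0 : 0 < b) (h1 : b < 1) (hc : 0 < c) (hc1 : c < 1)
    (hs : s ∈ Ioo (0:ℝ) 1) :
    ∫ v in Ioi (0:ℝ), v ^ b / ((1 + c * v) * (s + v))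
      = π / Real.sin (π * b) * ((c ^ (-b) - s ^ b) / (1 - c * s)) := by
  rw [setIntegral_congr_fun measurableSet_Ioi
    (fun v hv => aux_inner_eq b c s v hc hc1 hs hv), integral_const_mul,
    integral_sub (aux_K_int b c 1 h0 h1 hc one_pos)
    ((aux_K_int b 1 s h0 h1 one_pos hs.1).const_mul s), integral_const_mul,
    aux_K b c 1 h0 h1 hc one_pos, aux_K b 1 s h0 h1 one_pos hs.1, Real.one_rpow, Real.one_rpow,
    Real.rpow_sub_one hs.1.ne']
  have := hs.1
  field_simp

/-- power bookkeeping -/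
lemma aux_pow (a b d z c v V D : ℝ) (hd : 0 < d) (hz : 0 < z) (hc : 0 < c) (hv : 0 < v)
    (hV : 0 < V) (hD : 0 < D) :
    (c * (d * z) / D ^ 2) * ((d * z * c * v / D) ^ (a + b - 1) * (d * c * V / D) ^ (-a)
      * (d * z / D) ^ (-b))
      = (z ^ a * c ^ b) * (v ^ (a + b - 1) * V ^ (-a) / D) := by
  rw [← Real.exp_log hd, ← Real.exp_log hz, ← Real.exp_log hc, ← Real.exp_log hv,
    ← Real.exp_log hV, ← Real.exp_log hD]
  simp only [← Real.exp_add, ← Real.exp_sub, ← Real.exp_mul, ← Real.exp_nat_mul]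
  congr 1
  push_cast
  ring

lemma aux_I1 (a b y : ℝ) (hy : y ∈ Ioo (-1:ℝ) 1) :
    ∫ t in Ioo (-1:ℝ) y, (y - t) ^ (a + b - 1) * (1 - t) ^ (-a) * (1 + t) ^ (-b)
      = (((1 + y) / 2) ^ a * ((1 - y) / 2) ^ b) *
        ∫ v in Ioi (0:ℝ), v ^ (a + b - 1) * (1 + v) ^ (-a) / (1 + (1 - y) / 2 * v) := by
  obtain ⟨c, hc⟩ : ∃ c, c = (1 - y) / 2 := ⟨_, rfl⟩
  obtain ⟨z, hz⟩ : ∃ z, z = (1 + y) / 2 := ⟨_, rfl⟩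
  have hc0 : 0 < c := by rw [hc]; linarith [hy.2]
  have hz0 : 0 < z := by rw [hz]; linarith [hy.1]
  have hyz : y = 2 * z - 1 := by rw [hz]; ring
  have hcz : c = 1 - z := by rw [hc, hz]; ring
  rw [← hc, ← hz]
  have him : (fun v : ℝ => (y - c * v) / (1 + c * v)) '' Ioi 0 = Ioo (-1) y := by
    ext t
    simp only [mem_image, mem_Ioi, mem_Ioo]
    constructor
    · rintro ⟨r, hr, rfl⟩
      have : 0 < c * r := by positivity
      have h1 : 0 < 1 + c * r := by positivity
      rw [lt_div_iff₀ h1, div_lt_iff₀ h1]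
      constructor <;> nlinarith [hy.1]
    · rintro ⟨h0, h1⟩
      have h2 : 0 < 1 + t := by linarith
      have h3 : 0 < y - t := by linarith
      refine ⟨(y - t) / (c * (1 + t)), by positivity, ?_⟩
      have e : c * ((y - t) / (c * (1 + t))) = (y - t) / (1 + t) := by field_simp
      have h4 : 1 + y ≠ 0 := by linarith [hy.1]
      rw [e, show 1 + (y - t) / (1 + t) = (1 + y) / (1 + t) by field_simp; ring]
      field_simp
      ring
  rw [← him, integral_image_eq_integral_abs_deriv_smul
    (f' := fun v => -(c * (2 * z) / (1 + c * v) ^ 2)) measurableSet_Ioi, ← integral_const_mul]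
  · apply setIntegral_congr_fun measurableSet_Ioi
    intro v hv
    have hv : 0 < v := hv
    have h1 : 0 < 1 + c * v := by positivity
    simp only [smul_eq_mul]
    rw [← aux_pow a b 2 z c v (1 + v) (1 + c * v) two_pos hz0 hc0 hv (by positivity) h1,
      abs_neg, abs_of_pos (by positivity)]
    congr 4
    · rw [hyz]; field_simp; ring
    · rw [hyz]; field_simp; rw [hcz]; ring
    · rw [hyz]; field_simp; ring
  · intro v hv
    have hv : 0 < v := hv
    have h1 : 1 + c * v ≠ 0 := by positivity
    have hd : HasDerivAt (fun v => c * v) c v := by simpa using (hasDerivAt_id v).const_mul c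
    have := ((hd.const_sub y).div (hd.const_add 1) h1).hasDerivWithinAt (s := Ioi 0)
    refine HasDerivWithinAt.congr_deriv this ?_
    rw [← neg_div]
    congr 1
    rw [hyz]; ring
  · intro r hr r' hr' h
    have hr : 0 < r := hr
    have hr' : 0 < r' := hr'
    have h1 : 0 < 1 + c * r := by positivity
    have h2 : 0 < 1 + c * r' := by positivity
    simp only [] at h
    rw [div_eq_div_iff h1.ne' h2.ne'] at h
    have : (c * (2 * z)) * (r - r') = 0 := by rw [hyz] at h; linarith
    have h3 : c * (2 * z) ≠ 0 := by positivity
    have := (mul_eq_zero.1 this).resolve_left h3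
    linarith

lemma aux_I2 (a b y : ℝ) (hy : y ∈ Ioo (-1:ℝ) 1) :
    ∫ t in Ioo y (1:ℝ), (t - y) ^ (a + b - 1) * (1 - t) ^ (-a) * (1 + t) ^ (-b)
      = (((1 + y) / 2) ^ a * ((1 - y) / 2) ^ b) *
        ∫ v in Ioo (0:ℝ) 1, v ^ (a + b - 1) * (1 - v) ^ (-a) / (1 - (1 - y) / 2 * v) := by
  obtain ⟨c, hc⟩ : ∃ c, c = (1 - y) / 2 := ⟨_, rfl⟩
  obtain ⟨z, hz⟩ : ∃ z, z = (1 + y) / 2 := ⟨_, rfl⟩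
  have hc0 : 0 < c := by rw [hc]; linarith [hy.2]
  have hz0 : 0 < z := by rw [hz]; linarith [hy.1]
  have hyz : y = 2 * z - 1 := by rw [hz]; ring
  have hcz : c = 1 - z := by rw [hc, hz]; ring
  have hpos : ∀ v ∈ Ioo (0:ℝ) 1, 0 < 1 - c * v := by
    intro v hv
    nlinarith [hv.1, hv.2]
  rw [← hc, ← hz]
  have him : (fun v : ℝ => (y + c * v) / (1 - c * v)) '' Ioo 0 1 = Ioo y 1 := by
    ext t
    simp only [mem_image, mem_Ioo]
    constructor
    · rintro ⟨r, hr, rfl⟩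
      have := hr.1
      have : 0 < c * r := by positivity
      have h1 : 0 < 1 - c * r := hpos r hr
      rw [lt_div_iff₀ h1, div_lt_iff₀ h1]
      constructor
      · nlinarith [hy.1]
      · nlinarith [hr.2]
    · rintro ⟨h0, h1⟩
      have h2 : 0 < 1 + t := by linarith [hy.1]
      have h3 : 0 < t - y := by linarith
      refine ⟨(t - y) / (c * (1 + t)), ⟨by positivity, ?_⟩, ?_⟩
      · rw [div_lt_one (by positivity), hc]
        nlinarith [hy.1]
      have e : c * ((t - y) / (c * (1 + t))) = (t - y) / (1 + t) := by field_simp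
      have h4 : 1 + y ≠ 0 := by linarith [hy.1]
      rw [e, show 1 - (t - y) / (1 + t) = (1 + y) / (1 + t) by field_simp; ring]
      field_simp
      ring
  rw [← him, integral_image_eq_integral_abs_deriv_smul
    (f' := fun v => (c * (2 * z) / (1 - c * v) ^ 2)) measurableSet_Ioo, ← integral_const_mul]
  · apply setIntegral_congr_fun measurableSet_Ioo
    intro v hv
    have h1 : 0 < 1 - c * v := hpos v hv
    simp only [smul_eq_mul]
    rw [← aux_pow a b 2 z c v (1 - v) (1 - c * v) two_pos hz0 hc0 hv.1 (by linarith [hv.2]) h1,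
      abs_of_pos (by positivity)]
    congr 4
    · rw [hyz]; field_simp; ring
    · rw [hyz]; field_simp; rw [hcz]; ring
    · rw [hyz]; field_simp; ring
  · intro v hv
    have h1 : 1 - c * v ≠ 0 := (hpos v hv).ne'
    have hd : HasDerivAt (fun v => c * v) c v := by simpa using (hasDerivAt_id v).const_mul c
    have := ((hd.const_add y).div (hd.const_sub 1) h1).hasDerivWithinAt (s := Ioo 0 1)
    refine HasDerivWithinAt.congr_deriv this ?_
    congr 1
    rw [hyz]; ring
  · intro r hr r' hr' h
    have h1 : 0 < 1 - c * r := hpos r hr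
    have h2 : 0 < 1 - c * r' := hpos r' hr'
    simp only [] at h
    rw [div_eq_div_iff h1.ne' h2.ne'] at h
    have : (c * (2 * z)) * (r - r') = 0 := by rw [hyz] at h; linarith
    have h3 : c * (2 * z) ≠ 0 := by positivity
    have := (mul_eq_zero.1 this).resolve_left h3
    linarith

/-- The kernel used for Fubini. -/
noncomputable def auxF (a b c v s : ℝ) : ℝ :=
  s ^ (a - 1) * (1 - s) ^ (-a) * (v ^ b / ((1 + c * v) * (s + v)))

lemma auxF_nonneg (a b c v s : ℝ) (hc : 0 < c) (hv : 0 < v) (hs : s ∈ Ioo (0:ℝ) 1) :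
    0 ≤ auxF a b c v s := by
  have h1 := hs.1
  have h2 : 0 < 1 - s := by linarith [hs.2]
  unfold auxF
  positivity

lemma auxF_v (a b c s : ℝ) (h0 : 0 < b) (h1 : b < 1) (hc : 0 < c) (hc1 : c < 1)
    (hs : s ∈ Ioo (0:ℝ) 1) :
    ∫ v in Ioi (0:ℝ), auxF a b c v s = π / Real.sin (π * b) *
      (c ^ (-b) * (s ^ (a - 1) * (1 - s) ^ (-a) / ((1 - c) * s + 1 * (1 - s)))
        - s ^ (a + b - 1) * (1 - s) ^ (-a) / (1 - c * s)) := by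
  unfold auxF
  rw [integral_const_mul, aux_inner b c s h0 h1 hc hc1 hs,
    show a + b - 1 = (a - 1) + b by ring, Real.rpow_add hs.1,
    show (1 - c) * s + 1 * (1 - s) = 1 - c * s by ring]
  ring

lemma auxF_s (a b c v : ℝ) (h0 : 0 < a) (h1 : a < 1) (hv : 0 < v) :
    ∫ s in Ioo (0:ℝ) 1, auxF a b c v s = π / Real.sin (π * a) *
      (v ^ (a + b - 1) * (1 + v) ^ (-a) / (1 + c * v)) := by
  have e : ∀ s, auxF a b c v s = (v ^ b / (1 + c * v)) *
      (s ^ (a - 1) * (1 - s) ^ (-a) / ((1 + v) * s + v * (1 - s))) := by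
    intro s
    unfold auxF
    rw [show (1 + v) * s + v * (1 - s) = s + v by ring, div_mul_eq_div_div]
    ring
  simp only [e]
  rw [integral_const_mul, aux_B a (1 + v) v h0 h1 (by linarith) hv,
    show a + b - 1 = (a - 1) + b by ring, Real.rpow_add hv]
  ring

lemma aux_second_int (a b c : ℝ) (h0 : 0 < a) (h1 : a < 1) (hb : 0 < b) (hc1 : c < 1) :
    IntegrableOn (fun s : ℝ => s ^ (a + b - 1) * (1 - s) ^ (-a) / (1 - c * s)) (Ioo 0 1) := by
  have hI := aux_B_int a (1 - c) 1 h0 h1 (by linarith) one_pos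
  refine Integrable.mono hI ?_ ?_
  · apply Measurable.aestronglyMeasurable
    fun_prop
  · refine (ae_restrict_iff' measurableSet_Ioo).2 (Filter.Eventually.of_forall ?_)
    intro s hs
    rw [show a + b - 1 = (a - 1) + b by ring, Real.rpow_add hs.1,
      show (1 - c) * s + 1 * (1 - s) = 1 - c * s by ring]
    have : s ^ (a - 1) * s ^ b * (1 - s) ^ (-a) / (1 - c * s)
      = s ^ b * (s ^ (a - 1) * (1 - s) ^ (-a) / (1 - c * s)) := by ring
    rw [this, norm_mul]
    apply mul_le_of_le_one_left (norm_nonneg _)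
    rw [Real.norm_of_nonneg (Real.rpow_nonneg hs.1.le _)]
    exact Real.rpow_le_one hs.1.le hs.2.le hb.le

lemma auxF_int (a b c : ℝ) (h0 : 0 < a) (h1 : a < 1) (hb : 0 < b) (hb1 : b < 1)
    (hc : 0 < c) (hc1 : c < 1) :
    Integrable (Function.uncurry (auxF a b c))
      ((volume.restrict (Ioi (0:ℝ))).prod (volume.restrict (Ioo (0:ℝ) 1))) := by
  have hm : Measurable (Function.uncurry (auxF a b c)) := by
    unfold auxF Function.uncurry
    fun_prop
  rw [integrable_prod_iff' hm.aestronglyMeasurable]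
  constructor
  · refine (ae_restrict_iff' measurableSet_Ioo).2 (Filter.Eventually.of_forall ?_)
    intro s hs
    have := (aux_inner_int b c s hb hb1 hc hc1 hs).const_mul (s ^ (a - 1) * (1 - s) ^ (-a))
    exact this
  · have hI := (((aux_B_int a (1 - c) 1 h0 h1 (by linarith) one_pos).const_mul (c ^ (-b))).sub
      (aux_second_int a b c h0 h1 hb hc1)).const_mul (π / Real.sin (π * b))
    refine IntegrableOn.congr_fun hI ?_ measurableSet_Ioo
    intro s hs
    have := auxF_v a b c s hb hb1 hc hc1 hs
    simp only [Pi.sub_apply]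
    rw [← this]
    apply setIntegral_congr_fun measurableSet_Ioi
    intro v hv
    exact (Real.norm_of_nonneg (auxF_nonneg a b c v s hc hv hs)).symm

lemma aux_main (a b c : ℝ) (h0 : 0 < a) (h1 : a < 1) (hb : 0 < b) (hb1 : b < 1)
    (hc : 0 < c) (hc1 : c < 1) :
    π / Real.sin (π * a) *
      (∫ v in Ioi (0:ℝ), v ^ (a + b - 1) * (1 + v) ^ (-a) / (1 + c * v))
      = π / Real.sin (π * b) * (c ^ (-b) * (π / Real.sin (π * a) * (1 - c) ^ (-a))
        - ∫ s in Ioo (0:ℝ) 1, s ^ (a + b - 1) * (1 - s) ^ (-a) / (1 - c * s)) := by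
  have h := integral_integral_swap (auxF_int a b c h0 h1 hb hb1 hc hc1)
  rw [setIntegral_congr_fun measurableSet_Ioi (fun v hv => auxF_s a b c v h0 h1 hv),
    setIntegral_congr_fun measurableSet_Ioo (fun s hs => auxF_v a b c s hb hb1 hc hc1 hs),
    integral_const_mul, integral_const_mul,
    integral_sub ((aux_B_int a (1 - c) 1 h0 h1 (by linarith) one_pos).const_mul (c ^ (-b)))
      (aux_second_int a b c h0 h1 hb hc1), integral_const_mul,
    aux_B a (1 - c) 1 h0 h1 (by linarith) one_pos, Real.one_rpow, mul_one] at h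
  exact h

/-- The measure on `(-1,1)` with density `φ(t) = (1-t)^{-αρ}(1+t)^{-αρ̂}` solves the
Abelian integral equation
`∫_{-1}^{1} (c_{α,ρ̂}·1_{t<y} + c_{α,ρ}·1_{t>y})·|t-y|^{α-1} φ(t) dt = 1` for `y ∈ (-1,1)`. -/
theorem abelian_equation_solution (α ρ : ℝ)
    (hα : α ∈ Set.Ioo (0:ℝ) 1 ∪ Set.Ioo (1:ℝ) 2) (hρ : ρ ∈ Set.Ioo (0:ℝ) 1)
    (hαρ : α * ρ < 1) (hαρ' : α * (1 - ρ) < 1)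
    (y : ℝ) (hy : y ∈ Set.Ioo (-1:ℝ) 1) :
    (Real.sin (π * α * (1 - ρ)) / π) *
        (∫ t in Set.Ioo (-1:ℝ) y,
          (y - t) ^ (α - 1) * (1 - t) ^ (-(α * ρ)) * (1 + t) ^ (-(α * (1 - ρ))))
      + (Real.sin (π * α * ρ) / π) *
        (∫ t in Set.Ioo y (1:ℝ),
          (t - y) ^ (α - 1) * (1 - t) ^ (-(α * ρ)) * (1 + t) ^ (-(α * (1 - ρ))))
      = 1 := by
  have hα0 : 0 < α := by
    rcases hα with h | h
    · exact h.1
    · linarith [h.1]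
  have ha : 0 < α * ρ := mul_pos hα0 hρ.1
  have hb : 0 < α * (1 - ρ) := mul_pos hα0 (by linarith [hρ.2])
  rw [mul_assoc π α (1 - ρ), mul_assoc π α ρ,
    show α - 1 = α * ρ + α * (1 - ρ) - 1 by ring]
  generalize α * ρ = a at *
  generalize α * (1 - ρ) = b at *
  rw [aux_I1 a b y hy, aux_I2 a b y hy]
  have hc : 0 < (1 - y) / 2 := by linarith [hy.2]
  have hc1 : (1 - y) / 2 < 1 := by linarith [hy.1]
  have hM := aux_main a b ((1 - y) / 2) ha hαρ hb hαρ' hc hc1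
  rw [show (1 + y) / 2 = 1 - (1 - y) / 2 by ring]
  generalize (1 - y) / 2 = c at *
  have hz : 0 < 1 - c := by linarith
  have sa := aux_sin_pos a ha hαρ
  have sb := aux_sin_pos b hb hαρ'
  have hπ := Real.pi_pos
  rw [Real.rpow_neg hc.le, Real.rpow_neg hz.le] at hM
  have hca : 0 < c ^ b := by positivity
  have hza : 0 < (1 - c) ^ a := by positivity
  generalize (∫ v in Ioi (0:ℝ), v ^ (a + b - 1) * (1 + v) ^ (-a) / (1 + c * v)) = I at *
  generalize (∫ v in Ioo (0:ℝ) 1, v ^ (a + b - 1) * (1 - v) ^ (-a) / (1 - c * v)) = J at *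
  generalize Real.sin (π * a) = x at *
  generalize Real.sin (π * b) = w at *
  generalize c ^ b = p at *
  generalize (1 - c) ^ a = q at *
  field_simp at hM ⊢
  linarith
end

section
/- Let α ∈ (0,1) ∪ (1,2) and ρ ∈ (0,1) satisfy αρ < 1 and α(1−ρ) < 1, and set ρ̂ = 1−ρ. Then for every x > 1 and every z ∈ (−1,1): (x+1)^{αρ}·(x−1)^{αρ̂}·∫_{−1}^{1} (1+s)^{−αρ}(1−s)^{−αρ̂}(x−s)^{−1}·((sin(παρ)/π)·1_{s<z} + (sin(παρ̂)/π)·1_{s>z})·|s−z|^{α−1} ds = (x−z)^{α−1}. -/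
open MeasureTheory Set Real

lemma aux_cov {f f' : ℝ → ℝ} {p q : ℝ} (hpq : p < q)
    (hd : ∀ x ∈ Icc p q, HasDerivAt f (f' x) x) (hpos : ∀ x ∈ Icc p q, 0 < f' x) :
    f '' Ioo p q = Ioo (f p) (f q) ∧ InjOn f (Ioo p q) := by
  have hc : ContinuousOn f (Icc p q) := fun x hx => (hd x hx).continuousAt.continuousWithinAt
  have hm : StrictMonoOn f (Icc p q) := by
    apply strictMonoOn_of_deriv_pos (convex_Icc p q) hc
    intro x hx
    have hx' := interior_subset hx
    rw [(hd x hx').deriv]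
    exact hpos x hx'
  refine ⟨Subset.antisymm ?_ (intermediate_value_Ioo hpq.le hc), hm.injOn.mono Ioo_subset_Icc_self⟩
  rintro _ ⟨x, hx, rfl⟩
  exact ⟨hm (left_mem_Icc.2 hpq.le) (Ioo_subset_Icc_self hx) hx.1,
    hm (Ioo_subset_Icc_self hx) (right_mem_Icc.2 hpq.le) hx.2⟩

lemma aux_cov_lint {f f' : ℝ → ℝ} {p q : ℝ} (hpq : p < q)
    (hd : ∀ x ∈ Icc p q, HasDerivAt f (f' x) x) (hpos : ∀ x ∈ Icc p q, 0 < f' x)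
    (g : ℝ → ENNReal) :
    ∫⁻ x in Ioo (f p) (f q), g x = ∫⁻ x in Ioo p q, ENNReal.ofReal (f' x) * g (f x) := by
  obtain ⟨h1, h2⟩ := aux_cov hpq hd hpos
  rw [← h1, lintegral_image_eq_lintegral_abs_deriv_mul measurableSet_Ioo
    (fun x hx => (hd x (Ioo_subset_Icc_self hx)).hasDerivWithinAt) h2]
  refine setLIntegral_congr_fun measurableSet_Ioo fun x hx => ?_
  simp only [abs_of_pos (hpos x (Ioo_subset_Icc_self hx))]

lemma aux_cov_int {f f' : ℝ → ℝ} {p q : ℝ} (hpq : p < q)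
    (hd : ∀ x ∈ Icc p q, HasDerivAt f (f' x) x) (hpos : ∀ x ∈ Icc p q, 0 < f' x)
    (g : ℝ → ℝ) :
    ∫ x in Ioo (f p) (f q), g x = ∫ x in Ioo p q, f' x * g (f x) := by
  obtain ⟨h1, h2⟩ := aux_cov hpq hd hpos
  rw [← h1, integral_image_eq_integral_abs_deriv_smul measurableSet_Ioo
    (fun x hx => (hd x (Ioo_subset_Icc_self hx)).hasDerivWithinAt) h2]
  refine setIntegral_congr_fun measurableSet_Ioo fun x hx => ?_
  simp only [abs_of_pos (hpos x (Ioo_subset_Icc_self hx)), smul_eq_mul]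

lemma aux_beta_s2 {a b : ℝ} (ha : 0 < a) (hb : 0 < b) :
    ∫⁻ x in Ioo (0:ℝ) 1, ENNReal.ofReal (x ^ (a - 1) * (1 - x) ^ (b - 1))
      = ENNReal.ofReal (ProbabilityTheory.beta a b) := by
  have h := ProbabilityTheory.lintegral_betaPDF_eq_one ha hb
  have hB := ProbabilityTheory.beta_pos ha hb
  rw [ProbabilityTheory.lintegral_betaPDF] at h
  have h2 : ∫⁻ x in Ioo (0:ℝ) 1, ENNReal.ofReal (x ^ (a - 1) * (1 - x) ^ (b - 1))
      = ∫⁻ x in Ioo (0:ℝ) 1, ENNReal.ofReal (ProbabilityTheory.beta a b) * ENNReal.ofReal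
        (1 / ProbabilityTheory.beta a b * x ^ (a - 1) * (1 - x) ^ (b - 1)) := by
    refine setLIntegral_congr_fun measurableSet_Ioo fun x hx => ?_
    simp only [← ENNReal.ofReal_mul hB.le]
    congr 1
    field_simp
  rw [h2, lintegral_const_mul' _ _ ENNReal.ofReal_ne_top, h, mul_one]

/-- inner Euler integral -/
lemma aux_inner_s2 {a b r : ℝ} (ha : 0 < a) (ha1 : a < 1) (hb : 0 < b) (hr : 0 < r) (hr1 : r < 1) :
    ∫⁻ v in Ioo (0:ℝ) 1, ENNReal.ofReal
        (v ^ (-a) * (1 - v) ^ (a + b - 1) * (1 - r * v) ^ (-b - 1))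
      = ENNReal.ofReal (ProbabilityTheory.beta (1 - a) (a + b) * (1 - r) ^ (a - 1)) := by
  have hB := ProbabilityTheory.beta_pos (show 0 < 1 - a by linarith) (show 0 < a + b by linarith)
  have hrv : ∀ v ∈ Icc (0:ℝ) 1, 0 < 1 - r * v := by
    intro v hv
    nlinarith [hv.1, hv.2]
  have hcov := aux_cov_lint (f := fun v => v * (1 - r) / (1 - r * v))
    (f' := fun v => (1 - r) / (1 - r * v) ^ 2) (p := 0) (q := 1) zero_lt_one
    (by
      intro v hv
      have h0 := (hrv v hv).ne'
      have h1 := ((hasDerivAt_id v).mul_const (1 - r)).div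
        (((hasDerivAt_id v).const_mul r).const_sub 1) h0
      refine h1.congr_deriv ?_
      simp only [id]
      congr 1
      ring)
    (by
      intro v hv
      have h0 := hrv v hv
      have : 0 < 1 - r := by linarith
      positivity)
    (fun x => ENNReal.ofReal (x ^ ((1 - a) - 1) * (1 - x) ^ ((a + b) - 1)))
  have e0 : (0:ℝ) * (1 - r) / (1 - r * 0) = 0 := by simp
  have e1 : (1:ℝ) * (1 - r) / (1 - r * 1) = 1 := by
    have : 1 - r ≠ 0 := by linarith
    field_simp
  simp only [e0, e1] at hcov
  rw [aux_beta_s2 (by linarith) (by linarith)] at hcov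
  rw [mul_comm, ENNReal.ofReal_mul (by have : 0 < 1 - r := by linarith
                                       positivity), hcov,
    ← lintegral_const_mul' _ _ ENNReal.ofReal_ne_top]
  refine setLIntegral_congr_fun measurableSet_Ioo fun v hv => ?_
  have h0 := hrv v (Ioo_subset_Icc_self hv)
  have h1 : 0 < 1 - r := by linarith
  have h2 := hv.1
  have h3 : 0 < 1 - v := by linarith [hv.2]
  have h4 : 1 - v * (1 - r) / (1 - r * v) = (1 - v) / (1 - r * v) := by
    rw [eq_div_iff h0.ne', sub_mul, div_mul_cancel₀ _ h0.ne']
    ring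
  simp only [h4]
  rw [← ENNReal.ofReal_mul (by positivity), ← ENNReal.ofReal_mul (by positivity)]
  congr 1
  apply Real.log_injOn_pos (mem_Ioi.2 (by positivity)) (mem_Ioi.2 (by positivity))
  simp (disch := positivity) only [Real.log_mul, Real.log_div, Real.log_rpow, Real.log_pow]
  push_cast
  ring

lemma aux_ftc {b v w : ℝ} (hb : 0 < b) (hw : 0 < w) (hw1 : w < 1) (hv : 0 < v) (hv1 : v < 1) :
    ∫⁻ r in Ioo (0:ℝ) w, ENNReal.ofReal (b * r ^ (b - 1) * (1 - r * v) ^ (-b - 1))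
      = ENNReal.ofReal (w ^ b * (1 - w * v) ^ (-b)) := by
  have hrv : ∀ r ∈ Icc (0:ℝ) w, 0 < 1 - r * v := by
    intro r hr
    nlinarith [hr.1, hr.2]
  have hc : ContinuousOn (fun r : ℝ => r ^ b * (1 - r * v) ^ (-b)) (Icc 0 w) := by
    apply ContinuousOn.mul
    · exact (Real.continuous_rpow_const hb.le).continuousOn
    · apply ContinuousOn.rpow_const (by fun_prop)
      intro r hr
      exact Or.inl (hrv r hr).ne'
  have hd : ∀ r ∈ Ioo (0:ℝ) w, HasDerivAt (fun r : ℝ => r ^ b * (1 - r * v) ^ (-b))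
      (b * r ^ (b - 1) * (1 - r * v) ^ (-b - 1)) r := by
    intro r hr
    have h0 := hrv r (Ioo_subset_Icc_self hr)
    have h1 := (Real.hasDerivAt_rpow_const (x := r) (p := b) (Or.inl hr.1.ne')).mul
      ((((hasDerivAt_id r).mul_const v).const_sub 1).rpow_const (p := -b) (Or.inl h0.ne'))
    refine h1.congr_deriv ?_
    simp only [id]
    have e1 : r ^ b = r ^ (b - 1) * r := by
      rw [Real.rpow_sub_one hr.1.ne']; have := hr.1.ne'; field_simp
    have e2 : (1 - r * v) ^ (-b) = (1 - r * v) ^ (-b - 1) * (1 - r * v) := by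
      rw [Real.rpow_sub_one h0.ne']; field_simp
    rw [e1, e2]
    ring
  have hn : ∀ r ∈ Ioo (0:ℝ) w, 0 ≤ b * r ^ (b - 1) * (1 - r * v) ^ (-b - 1) := by
    intro r hr
    have h0 := hrv r (Ioo_subset_Icc_self hr)
    have h1 := hr.1
    positivity
  have hi := intervalIntegral.integrableOn_deriv_of_nonneg hc hd hn
  have hI := intervalIntegral.integral_eq_sub_of_hasDerivAt_of_le hw.le hc hd
    ((intervalIntegrable_iff_integrableOn_Ioc_of_le hw.le).2 hi)
  rw [intervalIntegral.integral_of_le hw.le, integral_Ioc_eq_integral_Ioo] at hI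
  rw [← ofReal_integral_eq_lintegral_ofReal (hi.mono_set Ioo_subset_Ioc_self)
    (ae_restrict_of_forall_mem measurableSet_Ioo hn), hI]
  simp [Real.zero_rpow hb.ne']

lemma aux_half {a b w : ℝ} (ha : 0 < a) (ha1 : a < 1) (hb : 0 < b) (hw : 0 < w) (hw1 : w < 1) :
    ∫⁻ t in Ioo (0:ℝ) w, ENNReal.ofReal
        (t ^ (-a) * (1 - t) ^ (-b) * (w - t) ^ (a + b - 1))
      = ENNReal.ofReal (b * ProbabilityTheory.beta (1 - a) (a + b)) *
        ∫⁻ r in Ioo (0:ℝ) w, ENNReal.ofReal (r ^ (b - 1) * (1 - r) ^ (a - 1)) := by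
  have hB := ProbabilityTheory.beta_pos (show 0 < 1 - a by linarith) (show 0 < a + b by linarith)
  have hcov := aux_cov_lint (f := fun v => w * v)
    (f' := fun v => w) (p := 0) (q := 1) zero_lt_one
    (fun v _ => by simpa using (hasDerivAt_id v).const_mul w)
    (fun v _ => hw) (fun t => ENNReal.ofReal
        (t ^ (-a) * (1 - t) ^ (-b) * (w - t) ^ (a + b - 1)))
  simp only [mul_zero, mul_one] at hcov
  rw [hcov]
  have s1 : ∫⁻ v in Ioo (0:ℝ) 1, ENNReal.ofReal w * ENNReal.ofReal
        ((w * v) ^ (-a) * (1 - w * v) ^ (-b) * (w - w * v) ^ (a + b - 1))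
      = ∫⁻ v in Ioo (0:ℝ) 1, ∫⁻ r in Ioo (0:ℝ) w,
        ENNReal.ofReal (v ^ (-a) * (1 - v) ^ (a + b - 1)) *
          ENNReal.ofReal (b * r ^ (b - 1) * (1 - r * v) ^ (-b - 1)) := by
    refine setLIntegral_congr_fun measurableSet_Ioo fun v hv => ?_
    have h1 := hv.1
    have h2 : 0 < 1 - v := by linarith [hv.2]
    have h3 : 0 < 1 - w * v := by nlinarith
    rw [lintegral_const_mul' _ _ ENNReal.ofReal_ne_top, aux_ftc hb hw hw1 hv.1 hv.2,
      ← ENNReal.ofReal_mul (by positivity), ← ENNReal.ofReal_mul (by positivity)]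
    congr 1
    rw [show w - w * v = w * (1 - v) by ring]
    apply Real.log_injOn_pos (mem_Ioi.2 (by positivity)) (mem_Ioi.2 (by positivity))
    simp (disch := positivity) only [Real.log_mul, Real.log_rpow]
    ring
  rw [s1, lintegral_lintegral_swap (by
    apply Measurable.aemeasurable
    unfold Function.uncurry
    fun_prop), ← lintegral_const_mul' _ _ ENNReal.ofReal_ne_top]
  refine setLIntegral_congr_fun measurableSet_Ioo fun r hr => ?_
  have h1 := hr.1
  have h2 : 0 < 1 - r := by linarith [hr.2]
  have s2 : ∫⁻ v in Ioo (0:ℝ) 1, ENNReal.ofReal (v ^ (-a) * (1 - v) ^ (a + b - 1)) *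
          ENNReal.ofReal (b * r ^ (b - 1) * (1 - r * v) ^ (-b - 1))
      = ∫⁻ v in Ioo (0:ℝ) 1, ENNReal.ofReal (b * r ^ (b - 1)) * ENNReal.ofReal
        (v ^ (-a) * (1 - v) ^ (a + b - 1) * (1 - r * v) ^ (-b - 1)) := by
    refine setLIntegral_congr_fun measurableSet_Ioo fun v hv => ?_
    have h1 := hv.1
    have h2 : 0 < 1 - v := by linarith [hv.2]
    rw [← ENNReal.ofReal_mul (by positivity), ← ENNReal.ofReal_mul (by positivity)]
    congr 1
    ring
  simp only [s2]
  rw [lintegral_const_mul' _ _ ENNReal.ofReal_ne_top,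
    aux_inner_s2 ha ha1 hb hr.1 (hr.2.trans hw1),
    ← ENNReal.ofReal_mul (by positivity), ← ENNReal.ofReal_mul (by positivity)]
  congr 1
  ring

lemma aux_const {a b : ℝ} (ha : 0 < a) (ha1 : a < 1) (hb : 0 < b) :
    sin (π * a) / π * (b * ProbabilityTheory.beta (1 - a) (a + b))
      = 1 / ProbabilityTheory.beta b a := by
  have hs : 0 < sin (π * a) := Real.sin_pos_of_pos_of_lt_pi (by positivity)
    (by nlinarith [Real.pi_pos])
  have h := Real.Gamma_mul_Gamma_one_sub a
  have g1 := Real.Gamma_pos_of_pos ha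
  have g2 := Real.Gamma_pos_of_pos hb
  have g3 := Real.Gamma_pos_of_pos (show 0 < a + b by linarith)
  have hpi := Real.pi_pos
  unfold ProbabilityTheory.beta
  rw [show 1 - a + (a + b) = b + 1 by ring, Real.Gamma_add_one hb.ne', add_comm b a]
  rw [eq_div_iff hs.ne'] at h
  field_simp
  linarith

lemma aux_half' {a b w : ℝ} (ha : 0 < a) (ha1 : a < 1) (hb : 0 < b) (hw : 0 < w) (hw1 : w < 1) :
    ∫⁻ t in Ioo (0:ℝ) w, ENNReal.ofReal
        (sin (π * a) / π * (t ^ (-a) * (1 - t) ^ (-b) * (w - t) ^ (a + b - 1)))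
      = ENNReal.ofReal (1 / ProbabilityTheory.beta b a) *
        ∫⁻ r in Ioo (0:ℝ) w, ENNReal.ofReal (r ^ (b - 1) * (1 - r) ^ (a - 1)) := by
  have hs : 0 < sin (π * a) := Real.sin_pos_of_pos_of_lt_pi (by positivity)
    (by nlinarith [Real.pi_pos])
  have hpi := Real.pi_pos
  rw [← aux_const ha ha1 hb, ENNReal.ofReal_mul (by positivity), mul_assoc,
    ← aux_half ha ha1 hb hw hw1, ← lintegral_const_mul' _ _ ENNReal.ofReal_ne_top]
  simp_rw [ENNReal.ofReal_mul (show 0 ≤ sin (π * a) / π by positivity)]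

lemma aux_refl (w : ℝ) (g : ℝ → ENNReal) :
    ∫⁻ t in Ioo w 1, g t = ∫⁻ t in Ioo 0 (1 - w), g (1 - t) := by
  have h := lintegral_image_eq_lintegral_abs_deriv_mul (f := fun t : ℝ => 1 - t)
    (f' := fun _ => -1) (s := Ioo 0 (1 - w)) measurableSet_Ioo
    (fun t _ => ((hasDerivAt_id t).const_sub 1).hasDerivWithinAt)
    (fun x _ y _ h => by simpa using h) g
  simpa using h

lemma aux_unit {a b w : ℝ} (ha : 0 < a) (ha1 : a < 1) (hb : 0 < b) (hb1 : b < 1)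
    (hw : 0 < w) (hw1 : w < 1) :
    ∫ t in Ioo (0:ℝ) 1, t ^ (-a) * (1 - t) ^ (-b) *
      (((if t < w then sin (π * a) / π else 0) + (if w < t then sin (π * b) / π else 0))
        * |t - w| ^ (a + b - 1)) = 1 := by
  have hpi := Real.pi_pos
  have hs : 0 < sin (π * a) := Real.sin_pos_of_pos_of_lt_pi (by positivity) (by nlinarith)
  have hs' : 0 < sin (π * b) := Real.sin_pos_of_pos_of_lt_pi (by positivity) (by nlinarith)
  rw [integral_eq_lintegral_of_nonneg_ae]
  rotate_left
  · refine ae_restrict_of_forall_mem measurableSet_Ioo fun t ht => ?_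
    have h1 := ht.1
    have h2 : 0 < 1 - t := by linarith [ht.2]
    simp only [Pi.zero_apply]
    positivity
  · apply Measurable.aestronglyMeasurable
    have m1 : Measurable fun t : ℝ => if t < w then sin (π * a) / π else 0 :=
      Measurable.ite measurableSet_Iio measurable_const measurable_const
    have m2 : Measurable fun t : ℝ => if w < t then sin (π * b) / π else 0 :=
      Measurable.ite measurableSet_Ioi measurable_const measurable_const
    have m3 : Measurable fun t : ℝ => |t - w| := by fun_prop
    fun_prop
  have split : ∀ g : ℝ → ENNReal, ∫⁻ t in Ioo (0:ℝ) 1, g t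
      = (∫⁻ t in Ioo 0 w, g t) + ∫⁻ t in Ioo w 1, g t := by
    intro g
    rw [← Ioo_union_Ico_eq_Ioo hw hw1.le, lintegral_union measurableSet_Ico,
      setLIntegral_congr (Ioo_ae_eq_Ico (a := w) (b := (1:ℝ)))]
    rw [Set.disjoint_left]
    intro t h1 h2
    exact absurd h1.2 (not_lt.2 h2.1)
  have p1 : ∫⁻ t in Ioo 0 w, ENNReal.ofReal (t ^ (-a) * (1 - t) ^ (-b) *
      (((if t < w then sin (π * a) / π else 0) + (if w < t then sin (π * b) / π else 0))
        * |t - w| ^ (a + b - 1))) = ENNReal.ofReal (1 / ProbabilityTheory.beta b a) *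
        ∫⁻ r in Ioo (0:ℝ) w, ENNReal.ofReal (r ^ (b - 1) * (1 - r) ^ (a - 1)) := by
    rw [← aux_half' ha ha1 hb hw hw1]
    refine setLIntegral_congr_fun measurableSet_Ioo fun t ht => ?_
    simp only [if_pos ht.2, if_neg ht.2.not_gt, abs_of_neg (sub_neg.2 ht.2), neg_sub]
    congr 1
    ring
  have p2 : ∫⁻ t in Ioo w 1, ENNReal.ofReal (t ^ (-a) * (1 - t) ^ (-b) *
      (((if t < w then sin (π * a) / π else 0) + (if w < t then sin (π * b) / π else 0))
        * |t - w| ^ (a + b - 1))) = ENNReal.ofReal (1 / ProbabilityTheory.beta b a) *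
        ∫⁻ r in Ioo w 1, ENNReal.ofReal (r ^ (b - 1) * (1 - r) ^ (a - 1)) := by
    rw [aux_refl w (fun r => ENNReal.ofReal (r ^ (b - 1) * (1 - r) ^ (a - 1)))]
    have hh := aux_half' hb hb1 ha (show 0 < 1 - w by linarith) (by linarith)
    have e : ProbabilityTheory.beta b a = ProbabilityTheory.beta a b := by
      unfold ProbabilityTheory.beta
      rw [add_comm, mul_comm]
    have e2 : ∀ r : ℝ, (1 - r) ^ (b - 1) * (1 - (1 - r)) ^ (a - 1)
        = r ^ (a - 1) * (1 - r) ^ (b - 1) := by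
      intro r
      rw [sub_sub_cancel, mul_comm]
    simp only [e2]
    rw [e, ← hh, aux_refl w]
    refine setLIntegral_congr_fun measurableSet_Ioo fun t ht => ?_
    have h1 : w < 1 - t := by linarith [ht.2]
    simp only [if_pos h1, if_neg h1.not_gt, abs_of_pos (sub_pos.2 h1), sub_sub_cancel]
    congr 1
    rw [show 1 - t - w = 1 - w - t by ring, add_comm a b]
    ring
  rw [split, p1, p2, ← mul_add, ← split, aux_beta_s2 hb ha]
  have hB := ProbabilityTheory.beta_pos hb ha
  rw [← ENNReal.ofReal_mul (by positivity), one_div, inv_mul_cancel₀ hB.ne']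
  simp

theorem transformed_abelian_equation (α ρ : ℝ)
    (hα : α ∈ Set.Ioo (0:ℝ) 1 ∪ Set.Ioo (1:ℝ) 2) (hρ : ρ ∈ Set.Ioo (0:ℝ) 1)
    (hαρ : α * ρ < 1) (hαρ' : α * (1 - ρ) < 1)
    (x : ℝ) (hx : 1 < x) (z : ℝ) (hz : z ∈ Set.Ioo (-1:ℝ) 1) :
    (x + 1) ^ (α * ρ) * (x - 1) ^ (α * (1 - ρ)) *
        (∫ s in Set.Ioo (-1:ℝ) 1,
          (1 + s) ^ (-(α * ρ)) * (1 - s) ^ (-(α * (1 - ρ))) * (x - s)⁻¹ *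
            (((if s < z then Real.sin (π * α * ρ) / π else 0)
              + (if z < s then Real.sin (π * α * (1 - ρ)) / π else 0))
              * |s - z| ^ (α - 1)))
      = (x - z) ^ (α - 1) := by
  have hα0 : 0 < α := by
    rcases hα with h | h
    · exact h.1
    · linarith [h.1]
  have ha : 0 < α * ρ := mul_pos hα0 hρ.1
  have hb : 0 < α * (1 - ρ) := mul_pos hα0 (by linarith [hρ.2])
  have hab : α = α * ρ + α * (1 - ρ) := by ring
  rw [mul_assoc π α ρ, mul_assoc π α (1 - ρ), show α - 1 = α * ρ + α * (1 - ρ) - 1 by ring]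
  generalize α * ρ = a at *
  generalize α * (1 - ρ) = b at *
  obtain ⟨hz1, hz2⟩ := hz
  have hx1 : 0 < x - 1 := by linarith
  have hx2 : 0 < x + 1 := by linarith
  have hxz : 0 < x - z := by linarith
  have hxs : ∀ s ∈ Icc (-1:ℝ) 1, 0 < x - s := fun s hs => by linarith [hs.2]
  have hcov := aux_cov_int (f := fun s => (s + 1) * (x - 1) / (2 * (x - s)))
    (f' := fun s => (x - 1) * (x + 1) / (2 * (x - s) ^ 2)) (p := -1) (q := 1) (by norm_num)
    (by
      intro s hs
      have h0 := hxs s hs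
      have h1 := (((hasDerivAt_id s).add_const 1).mul_const (x - 1)).div
        (((hasDerivAt_id s).const_sub x).const_mul 2) (by simpa using h0.ne')
      refine h1.congr_deriv ?_
      simp only [id]
      field_simp
      ring)
    (by
      intro s hs
      have h0 := hxs s hs
      positivity)
    (fun t => t ^ (-a) * (1 - t) ^ (-b) *
      (((if t < (z + 1) * (x - 1) / (2 * (x - z)) then sin (π * a) / π else 0)
        + (if (z + 1) * (x - 1) / (2 * (x - z)) < t then sin (π * b) / π else 0))
        * |t - (z + 1) * (x - 1) / (2 * (x - z))| ^ (a + b - 1)))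
  have e0 : ((-1:ℝ) + 1) * (x - 1) / (2 * (x - -1)) = 0 := by simp
  have e1 : ((1:ℝ) + 1) * (x - 1) / (2 * (x - 1)) = 1 := by field_simp; norm_num
  simp only [e0, e1] at hcov
  have hw : 0 < (z + 1) * (x - 1) / (2 * (x - z)) := by
    have : 0 < z + 1 := by linarith
    positivity
  have hw1 : (z + 1) * (x - 1) / (2 * (x - z)) < 1 := by
    rw [div_lt_one (by positivity)]
    nlinarith
  rw [aux_unit ha hαρ hb hαρ' hw hw1] at hcov
  rw [← integral_const_mul]
  refine Eq.trans ?_ (mul_one ((x - z) ^ (a + b - 1)))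
  refine Eq.trans ?_ (congrArg (fun y => (x - z) ^ (a + b - 1) * y) hcov.symm)
  rw [← integral_const_mul]
  refine setIntegral_congr_fun measurableSet_Ioo fun s hs => ?_
  have h0 := hxs s (Ioo_subset_Icc_self hs)
  have h1 : 0 < 1 + s := by linarith [hs.1]
  have h2 : 0 < 1 - s := by linarith [hs.2]
  have d1 : (s + 1) * (x - 1) / (2 * (x - s)) - (z + 1) * (x - 1) / (2 * (x - z))
      = (s - z) * ((x - 1) * (x + 1) / (2 * (x - s) * (x - z))) := by
    field_simp
    ring
  have d2 : 1 - (s + 1) * (x - 1) / (2 * (x - s)) = (1 - s) * (x + 1) / (2 * (x - s)) := by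
    field_simp
    ring
  have hk : 0 < (x - 1) * (x + 1) / (2 * (x - s) * (x - z)) := by positivity
  have d3 : (s + 1) * (x - 1) / (2 * (x - s)) < (z + 1) * (x - 1) / (2 * (x - z)) ↔ s < z := by
    rw [← sub_neg, d1, ← sub_neg (a := s)]
    exact ⟨fun h => by by_contra hc; exact absurd h (not_lt.2 (mul_nonneg (not_lt.1 hc) hk.le)),
      fun h => mul_neg_of_neg_of_pos h hk⟩
  have d4 : (z + 1) * (x - 1) / (2 * (x - z)) < (s + 1) * (x - 1) / (2 * (x - s)) ↔ z < s := by
    rw [← sub_pos, d1, mul_pos_iff_of_pos_right hk, sub_pos]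
  simp only [d1, d2, d3, d4]
  rcases eq_or_ne s z with rfl | hne
  · simp
  have h5 : 0 < |s - z| := abs_pos.2 (sub_ne_zero.2 hne)
  rw [abs_mul, abs_of_pos hk, add_comm s 1]
  generalize ((if s < z then sin (π * a) / π else 0)
        + (if z < s then sin (π * b) / π else 0)) = C
  have key : (x + 1) ^ a * (x - 1) ^ b * ((1 + s) ^ (-a) * (1 - s) ^ (-b) * (x - s)⁻¹ *
      |s - z| ^ (a + b - 1)) = (x - z) ^ (a + b - 1) * ((x - 1) * (x + 1) / (2 * (x - s) ^ 2) *
      (((1 + s) * (x - 1) / (2 * (x - s))) ^ (-a) * ((1 - s) * (x + 1) / (2 * (x - s))) ^ (-b) *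
      (|s - z| * ((x - 1) * (x + 1) / (2 * (x - s) * (x - z)))) ^ (a + b - 1))) := by
    apply Real.log_injOn_pos (mem_Ioi.2 (by positivity)) (mem_Ioi.2 (by positivity))
    simp (disch := positivity) only [Real.log_mul, Real.log_div, Real.log_rpow, Real.log_pow,
      Real.log_inv]
    push_cast
    ring
  linear_combination C * key
end

section
/- Let α ∈ (0,1) ∪ (1,2) and ρ ∈ (0,1) satisfy αρ < 1 and α(1−ρ) < 1, and set ρ̂ = 1−ρ, c_{α,ρ} = sin(παρ)/π, c_{α,ρ̂} = sin(παρ̂)/π. For x ∈ (−1,1) define h(x,t) = c_{α,ρ}·(1+x)^{αρ̂}(1−x)^{αρ}(1+t)^{−αρ̂}(t−1)^{−αρ}(t−x)^{−1} for t > 1 and h(x,t) = c_{α,ρ̂}·(1−x)^{αρ}(1+x)^{αρ̂}(1−t)^{−αρ}(−1−t)^{−αρ̂}(x−t)^{−1} for t < −1. Then for every x ∈ (−1,1) and every y with |y| > 1: ∫_{ℝ∖[−1,1]} (c_{α,ρ}·1_{t<y} + c_{α,ρ̂}·1_{t>y})·|t−y|^{α−1}·h(x,t) dt = (c_{α,ρ}·1_{x<y}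 + c_{α,ρ̂}·1_{x>y})·|x−y|^{α−1}. -/
open MeasureTheory Set Real

lemma exists_exp {x : ℝ} (hx : 0 < x) : ∃ l, x = Real.exp l := ⟨Real.log x, (Real.exp_log hx).symm⟩

lemma lint_beta {p q : ℝ} (hp : 0 < p) (hq : 0 < q) :
    ∫⁻ s in Ioo (0:ℝ) 1, ENNReal.ofReal (s ^ (p - 1) * (1 - s) ^ (q - 1))
      = ENNReal.ofReal (ProbabilityTheory.beta p q) := by
  have h1 := ProbabilityTheory.lintegral_betaPDF_eq_one hp hq
  have hb := ProbabilityTheory.beta_pos hp hq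
  rw [ProbabilityTheory.lintegral_betaPDF] at h1
  have : ∀ s : ℝ, ENNReal.ofReal (s ^ (p - 1) * (1 - s) ^ (q - 1))
      = ENNReal.ofReal (ProbabilityTheory.beta p q) *
        ENNReal.ofReal (1 / ProbabilityTheory.beta p q * s ^ (p - 1) * (1 - s) ^ (q - 1)) := by
    intro s
    rw [← ENNReal.ofReal_mul hb.le]
    congr 1
    field_simp
  simp_rw [this]
  rw [lintegral_const_mul' _ _ ENNReal.ofReal_ne_top, h1, mul_one]

lemma lint_pow {a r u : ℝ} (ha : 0 < a) (hr : r ∈ Ioo (0:ℝ) 1) (hu : u ∈ Ioo (0:ℝ) 1) :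
    ∫⁻ s in Ioo (0:ℝ) r, ENNReal.ofReal (a * s ^ (a - 1) * (1 - s * u) ^ (-a - 1))
      = ENNReal.ofReal (r ^ a * (1 - r * u) ^ (-a)) := by
  obtain ⟨hr0, hr1⟩ := hr
  obtain ⟨hu0, hu1⟩ := hu
  have hpos : ∀ s ∈ Icc (0:ℝ) r, 0 < 1 - s * u := by
    intro s hs
    nlinarith [hs.1, hs.2]
  have hc : ContinuousOn (fun s : ℝ => s ^ a * (1 - s * u) ^ (-a)) (Icc 0 r) := by
    apply ContinuousOn.mul
    · exact (Real.continuous_rpow_const ha.le).continuousOn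
    · apply ContinuousOn.rpow_const (by fun_prop)
      intro s hs; left; exact (hpos s hs).ne'
  have hd : ∀ s ∈ Ioo (0:ℝ) r, HasDerivAt (fun s : ℝ => s ^ a * (1 - s * u) ^ (-a))
      (a * s ^ (a - 1) * (1 - s * u) ^ (-a - 1)) s := by
    intro s hs
    have hP := hpos s ⟨hs.1.le, hs.2.le⟩
    have h1 : HasDerivAt (fun s : ℝ => s ^ a) (a * s ^ (a - 1)) s :=
      Real.hasDerivAt_rpow_const (Or.inl hs.1.ne')
    have h2 : HasDerivAt (fun s : ℝ => 1 - s * u) (-u) s := by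
      simpa using ((hasDerivAt_id s).mul_const u).const_sub 1
    have h3 := h1.mul (h2.rpow_const (p := -a) (Or.inl hP.ne'))
    refine HasDerivAt.congr_deriv (f := fun s : ℝ => s ^ a * (1 - s * u) ^ (-a)) h3 ?_
    have e1 : (1 - s * u) ^ (-a) = (1 - s * u) ^ (-a - 1) * (1 - s * u) := by
      rw [← Real.rpow_add_one hP.ne']; congr 1; ring
    have e2 : s ^ a = s ^ (a - 1) * s := by
      rw [← Real.rpow_add_one hs.1.ne']; congr 1; ring
    rw [e1, e2]; ring
  have hnn : ∀ s ∈ Ioo (0:ℝ) r, 0 ≤ a * s ^ (a - 1) * (1 - s * u) ^ (-a - 1) := by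
    intro s hs
    have hP := hpos s ⟨hs.1.le, hs.2.le⟩
    have := hs.1
    positivity
  have hi := intervalIntegral.integrableOn_deriv_of_nonneg hc hd hnn
  have hI := intervalIntegral.integral_eq_sub_of_hasDerivAt_of_le hr0.le hc hd
    ((intervalIntegrable_iff_integrableOn_Ioc_of_le hr0.le).2 hi)
  rw [intervalIntegral.integral_of_le hr0.le, integral_Ioc_eq_integral_Ioo] at hI
  rw [← ofReal_integral_eq_lintegral_ofReal (hi.mono_set Ioo_subset_Ioc_self), hI]
  · congr 1
    simp [Real.zero_rpow ha.ne']
  · exact (ae_restrict_iff' measurableSet_Ioo).2 (Filter.Eventually.of_forall hnn)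

lemma alg2 {a b u Q W P : ℝ} (hu : 0 < u) (hQ : 0 < Q) (hW : 0 < W) (hP : 0 < P) :
    Q / P ^ 2 * ((u * Q / P) ^ (-b) * (W / P) ^ (a + b - 1))
      = Q ^ (1 - b) * (P ^ (-a - 1) * u ^ (-b) * W ^ (a + b - 1)) := by
  obtain ⟨u, rfl⟩ := exists_exp hu
  obtain ⟨Q, rfl⟩ := exists_exp hQ
  obtain ⟨W, rfl⟩ := exists_exp hW
  obtain ⟨P, rfl⟩ := exists_exp hP
  simp only [← Real.exp_add, ← Real.exp_sub, ← Real.exp_mul, ← Real.exp_nat_mul]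
  congr 1; push_cast; ring

lemma lint_inner {a b s : ℝ} (hs : s ∈ Ioo (0:ℝ) 1) :
    ∫⁻ u in Ioo (0:ℝ) 1, ENNReal.ofReal ((1 - s * u) ^ (-a - 1) * u ^ (-b) * (1 - u) ^ (a + b - 1))
      = ENNReal.ofReal ((1 - s) ^ (b - 1)) *
        ∫⁻ v in Ioo (0:ℝ) 1, ENNReal.ofReal (v ^ (-b) * (1 - v) ^ (a + b - 1)) := by
  obtain ⟨hs0, hs1⟩ := hs
  have hpos : ∀ u ∈ Ioo (0:ℝ) 1, 0 < 1 - s * u := by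
    intro u hu
    nlinarith [hu.1, hu.2]
  have hQ : 0 < 1 - s := by linarith
  have himg : (fun u : ℝ => u * (1 - s) / (1 - s * u)) '' Ioo 0 1 = Ioo 0 1 := by
    ext v
    constructor
    · rintro ⟨u, hu, rfl⟩
      have := hpos u hu
      refine ⟨div_pos (mul_pos hu.1 hQ) this, ?_⟩
      show u * (1 - s) / (1 - s * u) < 1
      rw [div_lt_one this]; nlinarith [hu.2]
    · rintro ⟨h0, h1⟩
      have hD : 0 < 1 - s + s * v := by nlinarith
      refine ⟨v / (1 - s + s * v), ⟨div_pos h0 hD, ?_⟩, ?_⟩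
      · rw [div_lt_one hD]; nlinarith
      · have : 1 - s * (v / (1 - s + s * v)) = (1 - s) / (1 - s + s * v) := by
          field_simp; ring
        show v / (1 - s + s * v) * (1 - s) / (1 - s * (v / (1 - s + s * v))) = v
        rw [this]
        field_simp
  have hinj : InjOn (fun u : ℝ => u * (1 - s) / (1 - s * u)) (Ioo 0 1) := by
    intro u hu w hw h
    have h1 := hpos u hu
    have h2 := hpos w hw
    simp only at h
    rw [div_eq_div_iff h1.ne' h2.ne'] at h
    have : (u - w) * (1 - s) = 0 := by linarith
    rcases mul_eq_zero.1 this with h | h <;> linarith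
  have hd : ∀ u ∈ Ioo (0:ℝ) 1, HasDerivWithinAt (fun u : ℝ => u * (1 - s) / (1 - s * u))
      ((1 - s) / (1 - s * u) ^ 2) (Ioo 0 1) u := by
    intro u hu
    have h1 := hpos u hu
    have h2 : HasDerivAt (fun u : ℝ => 1 - s * u) (-s) u := by
      simpa using ((hasDerivAt_id u).const_mul s).const_sub 1
    have h3 : HasDerivAt (fun u : ℝ => u * (1 - s)) (1 - s) u := by
      simpa using ((hasDerivAt_id u).mul_const (1 - s))
    refine (HasDerivAt.congr_deriv (f := fun u : ℝ => u * (1 - s) / (1 - s * u))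
      (h3.div h2 h1.ne') ?_).hasDerivWithinAt
    congr 1; ring
  have key := lintegral_image_eq_lintegral_abs_deriv_mul measurableSet_Ioo hd hinj
    (fun v => ENNReal.ofReal (v ^ (-b) * (1 - v) ^ (a + b - 1)))
  rw [himg] at key
  rw [key, ← lintegral_const_mul' _ _ ENNReal.ofReal_ne_top]
  refine setLIntegral_congr_fun measurableSet_Ioo fun u hu => ?_
  have hP := hpos u hu
  have hW : 0 < 1 - u := by linarith [hu.2]
  have e : 1 - u * (1 - s) / (1 - s * u) = (1 - u) / (1 - s * u) := by
    rw [eq_div_iff hP.ne', sub_mul, div_mul_cancel₀ _ hP.ne']; ring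
  rw [abs_of_pos (by positivity), ← ENNReal.ofReal_mul (by positivity), e, alg2 hu.1 hQ hW hP,
    ← ENNReal.ofReal_mul (by positivity), ← mul_assoc ((1 - s) ^ (b - 1)), ← Real.rpow_add hQ]
  congr 1
  simp

lemma alg3 {a b u r W P : ℝ} (hu : 0 < u) (hr : 0 < r) (hW : 0 < W) (hP : 0 < P) :
    r * (P ^ (-a) * (r * u) ^ (-b) * (r * W) ^ (a + b - 1))
      = r ^ a * P ^ (-a) * (u ^ (-b) * W ^ (a + b - 1)) := by
  obtain ⟨u, rfl⟩ := exists_exp hu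
  obtain ⟨r, rfl⟩ := exists_exp hr
  obtain ⟨W, rfl⟩ := exists_exp hW
  obtain ⟨P, rfl⟩ := exists_exp hP
  simp only [← Real.exp_add, ← Real.exp_mul]
  congr 1; ring

lemma lint_left {a b r : ℝ} (ha : 0 < a) (hr : r ∈ Ioo (0:ℝ) 1) :
    ∫⁻ s in Ioo (0:ℝ) r, ENNReal.ofReal ((1 - s) ^ (-a) * s ^ (-b) * (r - s) ^ (a + b - 1))
      = ENNReal.ofReal a * (∫⁻ v in Ioo (0:ℝ) 1, ENNReal.ofReal (v ^ (-b) * (1 - v) ^ (a + b - 1)))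
        * ∫⁻ s in Ioo (0:ℝ) r, ENNReal.ofReal (s ^ (a - 1) * (1 - s) ^ (b - 1)) := by
  have hr' := hr
  obtain ⟨hr0, hr1⟩ := hr
  have himg : (fun u : ℝ => r * u) '' Ioo 0 1 = Ioo 0 r := by
    rw [Set.image_mul_left_Ioo hr0]; simp
  have hd : ∀ u ∈ Ioo (0:ℝ) 1, HasDerivWithinAt (fun u : ℝ => r * u) r (Ioo 0 1) u := by
    intro u hu
    simpa using ((hasDerivAt_id u).const_mul r).hasDerivWithinAt
  have hinj : InjOn (fun u : ℝ => r * u) (Ioo 0 1) := (mul_right_injective₀ hr0.ne').injOn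
  have key := lintegral_image_eq_lintegral_abs_deriv_mul measurableSet_Ioo hd hinj
    (fun s => ENNReal.ofReal ((1 - s) ^ (-a) * s ^ (-b) * (r - s) ^ (a + b - 1)))
  rw [himg] at key
  rw [key]
  have step : ∀ u ∈ Ioo (0:ℝ) 1, ENNReal.ofReal |r| *
      ENNReal.ofReal ((1 - r * u) ^ (-a) * (r * u) ^ (-b) * (r - r * u) ^ (a + b - 1))
      = ∫⁻ s in Ioo (0:ℝ) r, ENNReal.ofReal (a * s ^ (a - 1) * (1 - s * u) ^ (-a - 1)) *
          ENNReal.ofReal (u ^ (-b) * (1 - u) ^ (a + b - 1)) := by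
    intro u hu
    have hP : 0 < 1 - r * u := by nlinarith [hu.1, hu.2]
    have hW : 0 < 1 - u := by linarith [hu.2]
    rw [lintegral_mul_const' _ _ ENNReal.ofReal_ne_top, lint_pow ha hr' hu, abs_of_pos hr0,
      ← ENNReal.ofReal_mul hr0.le, ← ENNReal.ofReal_mul (by positivity),
      ← alg3 hu.1 hr0 hW hP]
    congr 4; ring
  rw [setLIntegral_congr_fun measurableSet_Ioo step, lintegral_lintegral_swap (by fun_prop)]
  rw [← lintegral_const_mul _ (by fun_prop)]
  refine setLIntegral_congr_fun measurableSet_Ioo fun s hs => ?_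
  have hs' : s ∈ Ioo (0:ℝ) 1 := ⟨hs.1, hs.2.trans hr1⟩
  have hs0 := hs.1
  have hQ : 0 < 1 - s := by linarith [hs'.2]
  have h2 : ∀ u ∈ Ioo (0:ℝ) 1, ENNReal.ofReal (a * s ^ (a - 1) * (1 - s * u) ^ (-a - 1)) *
          ENNReal.ofReal (u ^ (-b) * (1 - u) ^ (a + b - 1)) =
      ENNReal.ofReal (a * s ^ (a - 1)) *
        ENNReal.ofReal ((1 - s * u) ^ (-a - 1) * u ^ (-b) * (1 - u) ^ (a + b - 1)) := by
    intro u hu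
    have hP : 0 < 1 - s * u := by nlinarith [hu.1, hu.2, hs'.2]
    rw [← ENNReal.ofReal_mul (by positivity), ← ENNReal.ofReal_mul (by positivity)]
    congr 1; ring
  rw [setLIntegral_congr_fun measurableSet_Ioo h2, lintegral_const_mul' _ _ ENNReal.ofReal_ne_top,
    lint_inner hs', ENNReal.ofReal_mul ha.le, ENNReal.ofReal_mul (by positivity)]
  ring

lemma lint_right {a b r : ℝ} (hb : 0 < b) (hr : r ∈ Ioo (0:ℝ) 1) :
    ∫⁻ s in Ioo r 1, ENNReal.ofReal ((1 - s) ^ (-a) * s ^ (-b) * (s - r) ^ (a + b - 1))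
      = ENNReal.ofReal b * (∫⁻ v in Ioo (0:ℝ) 1, ENNReal.ofReal (v ^ (-a) * (1 - v) ^ (a + b - 1)))
        * ∫⁻ s in Ioo r 1, ENNReal.ofReal (s ^ (a - 1) * (1 - s) ^ (b - 1)) := by
  have hl := lint_left (a := b) (b := a) hb (r := 1 - r) ⟨by linarith [hr.2], by linarith [hr.1]⟩
  have himg : (fun u : ℝ => 1 - u) '' Ioo r 1 = Ioo 0 (1 - r) := by simp
  have hd : ∀ u ∈ Ioo r 1, HasDerivWithinAt (fun u : ℝ => 1 - u) (-1) (Ioo r 1) u := by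
    intro u hu
    simpa using ((hasDerivAt_id u).const_sub 1).hasDerivWithinAt
  have hinj : InjOn (fun u : ℝ => 1 - u) (Ioo r 1) := by
    intro u _ w _ h
    simpa using h
  have key := fun g => lintegral_image_eq_lintegral_abs_deriv_mul measurableSet_Ioo hd hinj g
  rw [himg] at key
  rw [key, key] at hl
  simp only [abs_neg, abs_one, ENNReal.ofReal_one, one_mul, sub_sub_cancel] at hl
  rw [add_comm b a] at hl
  convert hl using 2
  · funext s
    congr 1
    rw [mul_comm ((1 - s) ^ _)]; congr 2; ring
  · congr 1
    funext s
    congr 1; rw [mul_comm]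

lemma const_eq {a b : ℝ} (ha : 0 < a) (ha1 : a < 1) (hb : 0 < b) (hb1 : b < 1) :
    Real.sin (π * a) * (b * ProbabilityTheory.beta (1 - a) (a + b)) * ProbabilityTheory.beta a b
      = π := by
  have h1 := Real.Gamma_mul_Gamma_one_sub a
  have hs : 0 < Real.sin (π * a) := Real.sin_pos_of_pos_of_lt_pi (by positivity)
    (by nlinarith [Real.pi_pos])
  have g1 := Real.Gamma_pos_of_pos ha
  have g2 := Real.Gamma_pos_of_pos hb
  have g3 := Real.Gamma_pos_of_pos (add_pos ha hb)
  have g4 := Real.Gamma_add_one hb.ne'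
  rw [ProbabilityTheory.beta, ProbabilityTheory.beta, show 1 - a + (a + b) = b + 1 by ring, g4]
  rw [eq_div_iff hs.ne'] at h1
  field_simp
  linarith

lemma lint_total {a b r : ℝ} (ha : 0 < a) (ha1 : a < 1) (hb : 0 < b) (hb1 : b < 1)
    (hr : r ∈ Ioo (0:ℝ) 1) :
    ∫⁻ s in Ioo (0:ℝ) 1, ENNReal.ofReal
      (((if r < s then Real.sin (π * a) else 0) + (if s < r then Real.sin (π * b) else 0))
        * |s - r| ^ (a + b - 1) * ((1 - s) ^ (-a) * s ^ (-b))) = ENNReal.ofReal π := by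
  have hsa : 0 < Real.sin (π * a) := Real.sin_pos_of_pos_of_lt_pi (by positivity)
    (by nlinarith [Real.pi_pos])
  have hsb : 0 < Real.sin (π * b) := Real.sin_pos_of_pos_of_lt_pi (by positivity)
    (by nlinarith [Real.pi_pos])
  have split : ∀ f : ℝ → ENNReal, ∫⁻ s in Ioo (0:ℝ) 1, f s
      = (∫⁻ s in Ioo (0:ℝ) r, f s) + ∫⁻ s in Ioo r 1, f s := by
    intro f
    rw [← Ioo_union_Ico_eq_Ioo hr.1 hr.2.le, lintegral_union measurableSet_Ico]
    · rw [setLIntegral_congr (Ioo_ae_eq_Ico (a := r) (b := (1:ℝ)))]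
    · rw [Set.disjoint_left]
      rintro s ⟨_, h1⟩ ⟨h2, _⟩
      linarith
  have hB := ProbabilityTheory.beta_pos ha hb
  have hB1 := ProbabilityTheory.beta_pos (sub_pos.2 ha1) (add_pos ha hb)
  have hB2 := ProbabilityTheory.beta_pos (sub_pos.2 hb1) (add_pos ha hb)
  have k1 := const_eq ha ha1 hb hb1
  have k2 := const_eq hb hb1 ha ha1
  have hsymm : ProbabilityTheory.beta b a = ProbabilityTheory.beta a b := by
    rw [ProbabilityTheory.beta, ProbabilityTheory.beta, mul_comm, add_comm]
  rw [hsymm, add_comm b a] at k2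
  have k3 := mul_right_cancel₀ hB.ne' (k2.trans k1.symm)
  have c1 : ∫⁻ v in Ioo (0:ℝ) 1, ENNReal.ofReal (v ^ (-a) * (1 - v) ^ (a + b - 1))
      = ENNReal.ofReal (ProbabilityTheory.beta (1 - a) (a + b)) := by
    rw [← lint_beta (sub_pos.2 ha1) (add_pos ha hb)]; simp
  have c2 : ∫⁻ v in Ioo (0:ℝ) 1, ENNReal.ofReal (v ^ (-b) * (1 - v) ^ (a + b - 1))
      = ENNReal.ofReal (ProbabilityTheory.beta (1 - b) (a + b)) := by
    rw [← lint_beta (sub_pos.2 hb1) (add_pos ha hb)]; simp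
  have hL : ∫⁻ s in Ioo (0:ℝ) r, ENNReal.ofReal
      (((if r < s then Real.sin (π * a) else 0) + (if s < r then Real.sin (π * b) else 0))
        * |s - r| ^ (a + b - 1) * ((1 - s) ^ (-a) * s ^ (-b)))
      = ENNReal.ofReal (Real.sin (π * b)) * ∫⁻ s in Ioo (0:ℝ) r,
        ENNReal.ofReal ((1 - s) ^ (-a) * s ^ (-b) * (r - s) ^ (a + b - 1)) := by
    rw [← lintegral_const_mul' _ _ ENNReal.ofReal_ne_top]
    refine setLIntegral_congr_fun measurableSet_Ioo fun s hs => ?_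
    have h1 := hs.2
    rw [← ENNReal.ofReal_mul hsb.le, if_neg h1.not_gt, if_pos h1, abs_sub_comm,
      abs_of_pos (sub_pos.2 h1)]
    congr 1; ring
  have hR : ∫⁻ s in Ioo r 1, ENNReal.ofReal
      (((if r < s then Real.sin (π * a) else 0) + (if s < r then Real.sin (π * b) else 0))
        * |s - r| ^ (a + b - 1) * ((1 - s) ^ (-a) * s ^ (-b)))
      = ENNReal.ofReal (Real.sin (π * a)) * ∫⁻ s in Ioo r 1,
        ENNReal.ofReal ((1 - s) ^ (-a) * s ^ (-b) * (s - r) ^ (a + b - 1)) := by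
    rw [← lintegral_const_mul' _ _ ENNReal.ofReal_ne_top]
    refine setLIntegral_congr_fun measurableSet_Ioo fun s hs => ?_
    have h1 := hs.1
    rw [← ENNReal.ofReal_mul hsa.le, if_neg h1.not_gt, if_pos h1,
      abs_of_pos (sub_pos.2 h1)]
    congr 1; ring
  rw [split, hL, hR, lint_left ha hr, lint_right hb hr, c1, c2,
    ← ENNReal.ofReal_mul ha.le, ← ENNReal.ofReal_mul hb.le, ← mul_assoc, ← mul_assoc, ← ENNReal.ofReal_mul hsa.le,
    ← ENNReal.ofReal_mul hsb.le, k3, ← mul_add, ← split, lint_beta ha hb,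
    ← ENNReal.ofReal_mul (by positivity), k1]

lemma int_total {a b r : ℝ} (ha : 0 < a) (ha1 : a < 1) (hb : 0 < b) (hb1 : b < 1)
    (hr : r ∈ Ioo (0:ℝ) 1) :
    ∫ s in Ioo (0:ℝ) 1,
      (((if r < s then Real.sin (π * a) else 0) + (if s < r then Real.sin (π * b) else 0))
        * |s - r| ^ (a + b - 1) * ((1 - s) ^ (-a) * s ^ (-b))) = π := by
  have hsa : 0 < Real.sin (π * a) := Real.sin_pos_of_pos_of_lt_pi (by positivity)
    (by nlinarith [Real.pi_pos])
  have hsb : 0 < Real.sin (π * b) := Real.sin_pos_of_pos_of_lt_pi (by positivity)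
    (by nlinarith [Real.pi_pos])
  rw [integral_eq_lintegral_of_nonneg_ae, lint_total ha ha1 hb hb1 hr,
    ENNReal.toReal_ofReal Real.pi_pos.le]
  · refine (ae_restrict_iff' measurableSet_Ioo).2 (Filter.Eventually.of_forall fun s hs => ?_)
    have h1 : 0 < 1 - s := by linarith [hs.2]
    have h0 := hs.1
    show (0:ℝ) ≤ _
    have : 0 ≤ (if r < s then Real.sin (π * a) else 0) + (if s < r then Real.sin (π * b) else 0) := by
      split_ifs <;> linarith
    positivity
  · apply Measurable.aestronglyMeasurable
    have m1 : Measurable fun s : ℝ => if r < s then Real.sin (π * a) else 0 :=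
      Measurable.ite measurableSet_Ioi measurable_const measurable_const
    have m2 : Measurable fun s : ℝ => if s < r then Real.sin (π * b) else 0 :=
      Measurable.ite measurableSet_Iio measurable_const measurable_const
    exact ((m1.add m2).mul (by fun_prop)).mul (by fun_prop)

lemma alg4 {a b A B N D Y M T : ℝ} (hA : 0 < A) (hB : 0 < B) (hN : 0 < N) (hD : 0 < D)
    (hY : 0 < Y) (hM : 0 < M) (hT : 0 < T) :
    Y ^ (a + b - 1) * (A * B / (2 * D ^ 2) * ((A * B * N / (2 * D * Y)) ^ (a + b - 1) *
      ((M * B / (2 * D)) ^ (-a) * (T * A / (2 * D)) ^ (-b))))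
    = B ^ b * A ^ a * T ^ (-b) * M ^ (-a) * D⁻¹ * N ^ (a + b - 1) := by
  obtain ⟨l, hl⟩ := exists_exp (show (0:ℝ) < 2 by norm_num)
  rw [hl]
  obtain ⟨A, rfl⟩ := exists_exp hA
  obtain ⟨B, rfl⟩ := exists_exp hB
  obtain ⟨N, rfl⟩ := exists_exp hN
  obtain ⟨D, rfl⟩ := exists_exp hD
  obtain ⟨Y, rfl⟩ := exists_exp hY
  obtain ⟨M, rfl⟩ := exists_exp hM
  obtain ⟨T, rfl⟩ := exists_exp hT
  rw [show Real.exp D ^ 2 = Real.exp (2 * D) by rw [two_mul, Real.exp_add]; ring]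
  simp only [← Real.exp_add, ← Real.exp_sub, ← Real.exp_mul, ← Real.exp_neg]
  congr 1; ring

lemma core {a b x y : ℝ} (ha : 0 < a) (ha1 : a < 1) (hb : 0 < b) (hb1 : b < 1)
    (hx : x ∈ Ioo (-1:ℝ) 1) (hy : 1 < y) (g : ℝ → ℝ)
    (hg1 : ∀ t, 1 < t → g t = (Real.sin (π * a) / π) * (1 + x) ^ b
          * (1 - x) ^ a * (1 + t) ^ (-b) * (t - 1) ^ (-a) * (t - x)⁻¹)
    (hg2 : ∀ t, t < -1 → g t = (Real.sin (π * b) / π) * (1 - x) ^ a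
          * (1 + x) ^ b * (1 - t) ^ (-a) * (-1 - t) ^ (-b) * (x - t)⁻¹) :
    ∫ t in {t : ℝ | 1 < |t|},
        ((if t < y then Real.sin (π * a) / π else 0)
          + (if y < t then Real.sin (π * b) / π else 0)) * |t - y| ^ (a + b - 1) * g t
      = Real.sin (π * a) / π * (y - x) ^ (a + b - 1) := by
  obtain ⟨hx0, hx1⟩ := hx
  have hA : 0 < 1 - x := by linarith
  have hB : 0 < 1 + x := by linarith
  have hY : 0 < y - x := by linarith
  set φ : ℝ → ℝ := fun t => (t + 1) * (1 - x) / (2 * (t - x)) with hφ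
  have hE : MeasurableSet {t : ℝ | 1 < |t|} := measurableSet_lt measurable_const measurable_abs
  have hne : ∀ t ∈ {t : ℝ | 1 < |t|}, t - x ≠ 0 := by
    intro t ht h0
    have : t = x := by linarith
    subst this
    have : |t| < 1 := abs_lt.2 ⟨hx0, hx1⟩
    exact absurd ht (not_lt.2 this.le)
  have hd : ∀ t ∈ {t : ℝ | 1 < |t|}, HasDerivWithinAt φ
      (-((1 - x) * (1 + x) / (2 * (t - x) ^ 2))) {t : ℝ | 1 < |t|} t := by
    intro t ht
    have h0 := hne t ht
    have h2 : HasDerivAt (fun t : ℝ => 2 * (t - x)) 2 t := by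
      simpa using ((hasDerivAt_id t).sub_const x).const_mul 2
    have h3 : HasDerivAt (fun t : ℝ => (t + 1) * (1 - x)) (1 - x) t := by
      simpa using (((hasDerivAt_id t).add_const 1).mul_const (1 - x))
    refine (HasDerivAt.congr_deriv (f := φ) (h3.div h2 (by positivity)) ?_).hasDerivWithinAt
    field_simp
    ring
  have hinj : InjOn φ {t : ℝ | 1 < |t|} := by
    intro t ht w hw h
    have h1 := hne t ht
    have h2 := hne w hw
    simp only [hφ] at h
    rw [div_eq_div_iff (by positivity) (by positivity)] at h
    have : (t - w) * ((1 - x) * (1 + x)) = 0 := by linarith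
    rcases mul_eq_zero.1 this with h | h
    · linarith
    · exact absurd h (by positivity)
  have himg : φ '' {t : ℝ | 1 < |t|} = Ioo 0 1 \ {(1 - x) / 2} := by
    ext s
    constructor
    · rintro ⟨t, ht, rfl⟩
      have h0 := hne t ht
      refine ⟨?_, ?_⟩
      · rcases lt_abs.1 (show 1 < |t| from ht) with h | h
        · have hD : 0 < t - x := by linarith
          refine ⟨?_, ?_⟩
          · show 0 < (t + 1) * (1 - x) / (2 * (t - x))
            have : 0 < t + 1 := by linarith
            positivity
          · show (t + 1) * (1 - x) / (2 * (t - x)) < 1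
            rw [div_lt_one (by positivity)]; nlinarith
        · have hD : 0 < x - t := by linarith
          have e : φ t = (-1 - t) * (1 - x) / (2 * (x - t)) := by
            rw [hφ]
            show (t + 1) * (1 - x) / (2 * (t - x)) = _
            rw [div_eq_div_iff (by positivity) (by positivity)]; ring
          rw [e]
          refine ⟨?_, ?_⟩
          · have : 0 < -1 - t := by linarith
            positivity
          · rw [div_lt_one (by positivity)]; nlinarith
      · rw [mem_singleton_iff]
        show ¬ ((t + 1) * (1 - x) / (2 * (t - x)) = (1 - x) / 2)
        rw [div_eq_div_iff (by positivity) (by positivity)]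
        intro h
        have : (1 - x) * (1 + x) = 0 := by linarith
        exact absurd this (by positivity)
    · rintro ⟨⟨h0, h1⟩, h2⟩
      rw [mem_singleton_iff] at h2
      have hD : 2 * s - 1 + x ≠ 0 := fun h => h2 (by linarith)
      have e1 : (1 - x + 2 * s * x) / (2 * s - 1 + x) - 1
          = 2 * (1 - x) * (1 - s) / (2 * s - 1 + x) := by field_simp; ring
      have e2 : (1 - x + 2 * s * x) / (2 * s - 1 + x) + 1
          = 2 * (1 + x) * s / (2 * s - 1 + x) := by field_simp; ring
      have e3 : (1 - x + 2 * s * x) / (2 * s - 1 + x) - x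
          = (1 - x) * (1 + x) / (2 * s - 1 + x) := by field_simp; ring
      have h1' : 0 < 1 - s := by linarith
      refine ⟨(1 - x + 2 * s * x) / (2 * s - 1 + x), ?_, ?_⟩
      · rcases lt_or_gt_of_ne hD with h | h
        · have : 2 * (1 + x) * s / (2 * s - 1 + x) < 0 :=
            div_neg_of_pos_of_neg (by positivity) h
          rw [← e2] at this
          show 1 < |(1 - x + 2 * s * x) / (2 * s - 1 + x)|
          refine lt_abs.2 (Or.inr ?_)
          linarith
        · have : 0 < 2 * (1 - x) * (1 - s) / (2 * s - 1 + x) := by positivity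
          rw [← e1] at this
          show 1 < |(1 - x + 2 * s * x) / (2 * s - 1 + x)|
          refine lt_abs.2 (Or.inl ?_)
          linarith
      · simp only [hφ]
        rw [e2, e3]
        field_simp
  have hyE : y ∈ {t : ℝ | 1 < |t|} := lt_abs.2 (Or.inl hy)
  have hr : φ y ∈ Ioo (0:ℝ) 1 := by
    have : φ y ∈ φ '' {t : ℝ | 1 < |t|} := mem_image_of_mem _ hyE
    rw [himg] at this
    exact this.1
  have hint := int_total ha ha1 hb hb1 hr
  have hae : (Ioo (0:ℝ) 1 \ {(1 - x) / 2} : Set ℝ) =ᵐ[volume] Ioo (0:ℝ) 1 :=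
    sdiff_null_ae_eq_self (by simp)
  rw [← setIntegral_congr_set hae, ← himg,
    integral_image_eq_integral_abs_deriv_smul hE hd hinj] at hint
  have hC : Real.sin (π * a) / π * (y - x) ^ (a + b - 1)
      = (Real.sin (π * a) / π * (y - x) ^ (a + b - 1) / π) * π := by
    field_simp
  rw [hC]
  refine Eq.trans ?_ (congrArg
    (fun z => (Real.sin (π * a) / π * (y - x) ^ (a + b - 1) / π) * z) hint)
  beta_reduce
  rw [← integral_const_mul]
  refine setIntegral_congr_fun hE fun t ht => ?_
  have h0 := hne t ht
  have hdiff : φ t - φ y = (1 - x) * (1 + x) * (y - t) / (2 * (t - x) * (y - x)) := by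
    simp only [hφ]; field_simp; ring
  have h1s : 1 - φ t = (t - 1) * (1 + x) / (2 * (t - x)) := by
    simp only [hφ]; field_simp; ring
  simp only [smul_eq_mul]
  rw [abs_neg, abs_of_pos (show 0 < (1 - x) * (1 + x) / (2 * (t - x) ^ 2) by positivity)]
  rcases lt_abs.1 (show 1 < |t| from ht) with h | h
  · have hD : 0 < t - x := by linarith
    have hM : 0 < t - 1 := by linarith
    have hT : 0 < t + 1 := by linarith
    rw [hg1 t h, h1s]
    rcases lt_trichotomy t y with hty | rfl | hty
    · have hN : 0 < y - t := by linarith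
      have hs : 0 < φ t - φ y := by rw [hdiff]; positivity
      rw [if_pos hty, if_neg hty.not_gt, if_pos (sub_pos.1 hs), if_neg (sub_pos.1 hs).not_gt,
        abs_of_pos hs, abs_sub_comm, abs_of_pos hN, hdiff]
      have := alg4 (a := a) (b := b) hA hB hN hD hY hM hT
      simp only [hφ]
      rw [add_comm 1 t]
      linear_combination (-(Real.sin (π * a) / π * (Real.sin (π * a) / π))) * this
    · simp
    · have hN : 0 < t - y := by linarith
      have hdiff' : φ y - φ t = (1 - x) * (1 + x) * (t - y) / (2 * (t - x) * (y - x)) := by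
        rw [← neg_sub, hdiff]; ring
      have hs : 0 < φ y - φ t := by rw [hdiff']; positivity
      rw [if_neg hty.not_gt, if_pos hty, if_neg (sub_pos.1 hs).not_gt, if_pos (sub_pos.1 hs),
        abs_sub_comm (φ t), abs_of_pos hs, abs_of_pos hN, hdiff']
      have := alg4 (a := a) (b := b) hA hB hN hD hY hM hT
      simp only [hφ]
      rw [add_comm 1 t]
      linear_combination (-(Real.sin (π * a) / π * (Real.sin (π * b) / π))) * this
  · have ht1 : t < -1 := by linarith
    have hD : 0 < x - t := by linarith
    have hM : 0 < 1 - t := by linarith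
    have hT : 0 < -1 - t := by linarith
    have hty : t < y := by linarith
    have hN : 0 < y - t := by linarith
    have h1s' : 1 - φ t = (1 - t) * (1 + x) / (2 * (x - t)) := by
      rw [h1s, div_eq_div_iff (by positivity) (by positivity)]; ring
    have hs' : φ t = (-1 - t) * (1 - x) / (2 * (x - t)) := by
      simp only [hφ]
      rw [div_eq_div_iff (by positivity) (by positivity)]; ring
    have hdiff' : φ y - φ t = (1 - x) * (1 + x) * (y - t) / (2 * (x - t) * (y - x)) := by
      rw [← neg_sub, hdiff, ← neg_div, div_eq_div_iff (by positivity) (by positivity)]; ring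
    have hs : 0 < φ y - φ t := by rw [hdiff']; positivity
    rw [hg2 t ht1, h1s', if_pos hty, if_neg hty.not_gt, if_neg (sub_pos.1 hs).not_gt,
      if_pos (sub_pos.1 hs),
      abs_sub_comm (φ t), abs_of_pos hs, abs_sub_comm, abs_of_pos hN, hdiff', hs',
      show (t - x) ^ 2 = (x - t) ^ 2 by ring]
    have := alg4 (a := a) (b := b) hA hB hN hD hY hM hT
    linear_combination (-(Real.sin (π * a) / π * (Real.sin (π * b) / π))) * this

/-- The harmonic density `h(x,·)` solves, for every `x ∈ (-1,1)` and `|y| > 1`,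
`∫_{ℝ∖[-1,1]} (c_{α,ρ}·1_{t<y} + c_{α,ρ̂}·1_{t>y})|t-y|^{α-1} h(x,t) dt
   = (c_{α,ρ}·1_{x<y} + c_{α,ρ̂}·1_{x>y})|x-y|^{α-1}`. -/
theorem harmonic_density_abelian_equation (α ρ : ℝ)
    (hα : α ∈ Set.Ioo (0:ℝ) 1 ∪ Set.Ioo (1:ℝ) 2) (hρ : ρ ∈ Set.Ioo (0:ℝ) 1)
    (hαρ : α * ρ < 1) (hαρ' : α * (1 - ρ) < 1)
    (h : ℝ → ℝ → ℝ)
    (hdef : ∀ x t : ℝ, x ∈ Set.Ioo (-1:ℝ) 1 →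
      (1 < t → h x t = (Real.sin (π * α * ρ) / π) * (1 + x) ^ (α * (1 - ρ))
          * (1 - x) ^ (α * ρ) * (1 + t) ^ (-(α * (1 - ρ))) * (t - 1) ^ (-(α * ρ))
          * (t - x)⁻¹)
      ∧ (t < -1 → h x t = (Real.sin (π * α * (1 - ρ)) / π) * (1 - x) ^ (α * ρ)
          * (1 + x) ^ (α * (1 - ρ)) * (1 - t) ^ (-(α * ρ)) * (-1 - t) ^ (-(α * (1 - ρ)))
          * (x - t)⁻¹))
    (x : ℝ) (hx : x ∈ Set.Ioo (-1:ℝ) 1) (y : ℝ) (hy : 1 < |y|) :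
    ∫ t in {t : ℝ | 1 < |t|},
        ((if t < y then Real.sin (π * α * ρ) / π else 0)
          + (if y < t then Real.sin (π * α * (1 - ρ)) / π else 0))
          * |t - y| ^ (α - 1) * h x t
      = ((if x < y then Real.sin (π * α * ρ) / π else 0)
          + (if y < x then Real.sin (π * α * (1 - ρ)) / π else 0))
          * |x - y| ^ (α - 1) := by
  obtain ⟨hρ0, hρ1⟩ := hρ
  have hα0 : 0 < α := by
    rcases hα with h | h
    · exact h.1
    · linarith [h.1]
  have ha : 0 < α * ρ := by positivity
  have hb : 0 < α * (1 - ρ) := mul_pos hα0 (by linarith)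
  have hsum : α - 1 = α * ρ + α * (1 - ρ) - 1 := by ring
  have hsum' : α - 1 = α * (1 - ρ) + α * ρ - 1 := by ring
  have hxx := hx
  obtain ⟨hx0, hx1⟩ := hx
  simp only [mul_assoc π] at hdef ⊢
  rcases lt_abs.1 hy with h1 | h1
  · rw [if_pos (show x < y by linarith), if_neg (show ¬ y < x by linarith), add_zero,
      abs_sub_comm, abs_of_pos (show 0 < y - x by linarith), hsum]
    exact core ha hαρ hb hαρ' hxx h1 (h x) (fun t ht => (hdef x t hxx).1 ht)
      (fun t ht => (hdef x t hxx).2 ht)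
  · rw [if_neg (show ¬ x < y by linarith), if_pos (show y < x by linarith), zero_add,
      abs_of_pos (show 0 < x - y by linarith), hsum']
    have key := core (x := -x) (y := -y) hb hαρ' ha hαρ ⟨by linarith, by linarith⟩ h1
      (fun t => h x (-t))
      (fun t ht => by
        rw [(hdef x (-t) hxx).2 (by linarith), show 1 + -x = 1 - x by ring,
          show 1 - -x = 1 + x by ring, show 1 - -t = 1 + t by ring, show -1 - -t = t - 1 by ring,
          show x - -t = t - -x by ring])
      (fun t ht => by
        rw [(hdef x (-t) hxx).1 (by linarith), show 1 + -x = 1 - x by ring,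
          show 1 - -x = 1 + x by ring, show 1 + -t = 1 - t by ring, show -t - 1 = -1 - t by ring,
          show -t - x = -x - t by ring])
    rw [show -y - -x = x - y by ring] at key
    rw [← key]
    rw [← (Measure.measurePreserving_neg (volume : Measure ℝ)).setIntegral_preimage_emb
      (Homeomorph.neg ℝ).measurableEmbedding]
    have hE : (fun t : ℝ => -t) ⁻¹' {t : ℝ | 1 < |t|} = {t : ℝ | 1 < |t|} := by
      ext t; simp
    have hE' : (Neg.neg : ℝ → ℝ) ⁻¹' {t : ℝ | 1 < |t|} = {t : ℝ | 1 < |t|} := hE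
    rw [hE']
    refine setIntegral_congr_fun
      (measurableSet_lt measurable_const measurable_abs) fun t _ => ?_
    have e1 : (-t < y) = (-y < t) := propext ⟨fun h => by linarith, fun h => by linarith⟩
    have e2 : (y < -t) = (t < -y) := propext ⟨fun h => by linarith, fun h => by linarith⟩
    have e3 : |-t - y| = |t - -y| := by rw [← abs_neg]; congr 1; ring
    simp only [e1, e2, e3]
    rw [add_comm (if -y < t then _ else _)]
end
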